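/- arXiv:1310.8442 — 3 statements merged into one kernel-verified Lean document; each statement's English description precedes it below -/
import Mathlib

section
/- Let t ≥ 5 be an integer and let H be a {1,3}-graph such that: the order of a maximum complete {1,3}-subgraph of H is t; the 3-uniform level hypergraph H^3 contains a maximum complete 3-uniform subgraph of order s with s ≥ t; and the number of edges of H^3 satisfies C(s,3) ≤ e(H^3) ≤ C(s,3) + C(t-1,2). Then λ'(H) = λ'(K_t^{{1,3}}) = 1 + (t-1)(t-2)/t². -/
open Finset

/-- λ'(H,x) = Σ_{e∈E} |e|! · ∏_{i∈e} x_i  (equals Σ_{j∈R(H)} j!·Σ_{|e|=j} ∏ x_i). -/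
noncomputable def lagPoly {n : ℕ} (E : Finset (Finset (Fin n))) (x : Fin n → ℝ) : ℝ :=
  ∑ e ∈ E, (Nat.factorial e.card : ℝ) * ∏ i ∈ e, x i

/-- A legal weighting: nonnegative entries summing to 1. -/
def isLegal {n : ℕ} (x : Fin n → ℝ) : Prop :=
  (∑ i, x i) = 1 ∧ ∀ i, 0 ≤ x i

/-- The Lagrangian λ'(H): the maximum of λ'(H,x) over legal weightings. -/
noncomputable def lagrangian {n : ℕ} (E : Finset (Finset (Fin n))) : ℝ :=
  sSup {v : ℝ | ∃ x : Fin n → ℝ, isLegal x ∧ lagPoly E x = v}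

/-- Edge set of the complete hypergraph K_t^R on vertex set [t]. -/
def completeEdges (t : ℕ) (R : Finset ℕ) : Finset (Finset (Fin t)) :=
  Finset.univ.filter (fun e => e.card ∈ R)

/-- S induces a complete R-subgraph: every subset of S with cardinality in R is an edge. -/
def isCompleteSub {n : ℕ} (E : Finset (Finset (Fin n))) (R : Finset ℕ) (S : Finset (Fin n)) : Prop :=
  ∀ e ⊆ S, e.card ∈ R → e ∈ E

/-- The maximum complete R-subgraph of H has order t. -/
def maxCompleteOrder {n : ℕ} (E : Finset (Finset (Fin n))) (R : Finset ℕ) (t : ℕ) : Prop :=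
  (∃ S, S.card = t ∧ isCompleteSub E R S) ∧ ∀ S, isCompleteSub E R S → S.card ≤ t

namespace Lag

variable {n : ℕ}

/-- plain weight polynomial of a family -/
noncomputable def pw (x : Fin n → ℝ) (G : Finset (Finset (Fin n))) : ℝ :=
  ∑ e ∈ G, ∏ i ∈ e, x i

open Classical in
noncomputable def D1 (R : Finset (Fin n)) (G : Finset (Finset (Fin n))) (i : Fin n) (x : Fin n → ℝ) : ℝ :=
  ∑ q ∈ powersetCard 2 R, if insert i q ∈ G then ∏ k ∈ q, x k else 0

open Classical in
noncomputable def D2 (R : Finset (Fin n)) (G : Finset (Finset (Fin n))) (i j : Fin n) (x : Fin n → ℝ) : ℝ :=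
  ∑ k ∈ R, if insert i (insert j {k}) ∈ G then x k else 0

lemma spc (s : Finset (Fin n)) (a : Fin n) (ha : a ∉ s) (k : ℕ) (f : Finset (Fin n) → ℝ) :
    ∑ q ∈ powersetCard (k+1) (insert a s), f q
      = ∑ q ∈ powersetCard (k+1) s, f q + ∑ q ∈ powersetCard k s, f (insert a q) := by
  rw [Finset.powersetCard_succ_insert ha, Finset.sum_union, Finset.sum_image]
  · intro p hp q hq h
    have hp' : a ∉ p := fun h' => ha ((mem_powersetCard.1 hp).1 h')
    have hq' : a ∉ q := fun h' => ha ((mem_powersetCard.1 hq).1 h')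
    rw [← erase_insert hp', ← erase_insert hq', h]
  · rw [Finset.disjoint_left]
    intro p hp hq
    obtain ⟨q, hq, rfl⟩ := mem_image.1 hq
    exact ha ((mem_powersetCard.1 hp).1 (mem_insert_self _ _))

lemma pc_empty2 : powersetCard 2 (∅ : Finset (Fin n)) = ∅ := rfl
lemma pc_empty3 : powersetCard 3 (∅ : Finset (Fin n)) = ∅ := rfl

lemma sp1 (s : Finset (Fin n)) (f : Finset (Fin n) → ℝ) :
    ∑ q ∈ powersetCard 1 s, f q = ∑ k ∈ s, f {k} := by
  rw [Finset.powersetCard_one, Finset.sum_map]; rfl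

lemma sp2_union (X Y : Finset (Fin n)) (h : Disjoint X Y) (f : Finset (Fin n) → ℝ) :
    ∑ q ∈ powersetCard 2 (X ∪ Y), f q = ∑ q ∈ powersetCard 2 X, f q + ∑ q ∈ powersetCard 2 Y, f q
      + ∑ a ∈ X, ∑ b ∈ Y, f {a, b} := by
  induction X using Finset.induction_on with
  | empty => simp [pc_empty2, pc_empty3]
  | insert a s ha ih =>
    rw [disjoint_insert_left] at h
    have h1 : a ∉ s ∪ Y := by simp [ha, h.1]
    rw [insert_union, spc _ a h1 1, spc _ a ha 1, ih h.2, sum_insert ha, sp1, sp1, sum_union h.2]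
    ring

/-- expansion -/
lemma pw_expand (V : Finset (Fin n)) (G : Finset (Finset (Fin n))) (hG : ∀ e ∈ G, e.card = 3)
    (hV : ∀ e ∈ G, e ⊆ V) (i j : Fin n) (hi : i ∈ V) (hj : j ∈ V) (hij : i ≠ j) (x : Fin n → ℝ) :
    pw x G = pw x (G.filter fun e => i ∉ e ∧ j ∉ e) + x i * D1 (V \ {i, j}) G i x
      + x j * D1 (V \ {i, j}) G j x + x i * x j * D2 (V \ {i, j}) G i j x := by
  classical
  set R := V \ {i, j} with hR
  have hiR : i ∉ R := by simp [hR]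
  have hjR : j ∉ R := by simp [hR]
  have hiR' : i ∉ insert j R := by simp [hiR, hij]
  have hVe : V = insert i (insert j R) := by
    ext k; simp only [hR, mem_insert, mem_sdiff, mem_singleton]
    by_cases h1 : k = i <;> by_cases h2 : k = j <;> simp_all
  have h0 : pw x G = ∑ e ∈ powersetCard 3 V, if e ∈ G then ∏ k ∈ e, x k else 0 := by
    rw [← sum_filter]
    apply sum_congr _ (fun _ _ => rfl)
    ext e
    simp only [mem_filter, mem_powersetCard]
    exact ⟨fun h => ⟨⟨hV e h, hG e h⟩, h⟩, fun h => h.2⟩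
  have h3 : pw x (G.filter fun e => i ∉ e ∧ j ∉ e)
      = ∑ e ∈ powersetCard 3 R, if e ∈ G then ∏ k ∈ e, x k else 0 := by
    rw [← sum_filter]
    apply sum_congr _ (fun _ _ => rfl)
    ext e
    simp only [mem_filter, mem_powersetCard]
    constructor
    · rintro ⟨h, h1, h2⟩
      refine ⟨⟨fun k hk => ?_, hG e h⟩, h⟩
      simp only [hR, mem_sdiff, mem_insert, mem_singleton]
      refine ⟨hV e h hk, ?_⟩
      rintro (rfl | rfl) <;> contradiction
    · rintro ⟨⟨h1, _⟩, h⟩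
      exact ⟨h, fun h' => hiR (h1 h'), fun h' => hjR (h1 h')⟩
  have key : ∀ (a : Fin n) (ha : a ∉ R), ∑ q ∈ powersetCard 2 R, (if insert a q ∈ G then ∏ k ∈ insert a q, x k else 0)
      = x a * D1 R G a x := by
    intro a ha
    rw [D1, mul_sum]
    apply sum_congr rfl
    intro q hq
    have : a ∉ q := fun h => ha ((mem_powersetCard.1 hq).1 h)
    rw [prod_insert this]; split_ifs <;> simp
  rw [h0, h3, hVe, spc _ i hiR' 2, spc _ j hjR 2, spc _ j hjR 1, sp1, key j hjR, key i hiR]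
  have h4 : ∑ k ∈ R, (if insert i (insert j {k}) ∈ G then ∏ l ∈ insert i (insert j {k}), x l else 0)
      = x i * x j * D2 R G i j x := by
    rw [D2, mul_sum]
    apply sum_congr rfl
    intro k hk
    have h1 : j ∉ ({k} : Finset (Fin n)) := by
      rw [mem_singleton]; rintro rfl; exact hjR hk
    have h2 : i ∉ insert j ({k} : Finset (Fin n)) := by
      rw [mem_insert, mem_singleton]; rintro (h | rfl)
      · exact hij h
      · exact hiR hk
    rw [prod_insert h2, prod_insert h1, prod_singleton]; split_ifs <;> ring
  rw [h4]
  ring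

/-- shift weight ε from i to j -/
noncomputable def sh (x : Fin n → ℝ) (i j : Fin n) (ε : ℝ) : Fin n → ℝ :=
  Function.update (Function.update x i (x i - ε)) j (x j + ε)

lemma sh_j (x : Fin n → ℝ) (i j : Fin n) (ε : ℝ) : sh x i j ε j = x j + ε := by simp [sh]
lemma sh_i (x : Fin n → ℝ) (i j : Fin n) (hij : i ≠ j) (ε : ℝ) : sh x i j ε i = x i - ε := by simp [sh, hij]
lemma sh_k (x : Fin n → ℝ) (i j k : Fin n) (hi : k ≠ i) (hj : k ≠ j) (ε : ℝ) : sh x i j ε k = x k := by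
  simp [sh, hi, hj]

lemma D1_congr (R : Finset (Fin n)) (G) (i : Fin n) (x y : Fin n → ℝ) (h : ∀ k ∈ R, x k = y k) :
    D1 R G i x = D1 R G i y := by
  classical
  rw [D1, D1]
  refine sum_congr rfl fun q hq => ?_
  rw [prod_congr rfl fun k hk => h k ((mem_powersetCard.1 hq).1 hk)]

lemma D2_congr (R : Finset (Fin n)) (G) (i j : Fin n) (x y : Fin n → ℝ) (h : ∀ k ∈ R, x k = y k) :
    D2 R G i j x = D2 R G i j y := by
  classical
  rw [D2, D2]
  refine sum_congr rfl fun k hk => ?_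
  rw [h k hk]

lemma pw_shift (V : Finset (Fin n)) (G : Finset (Finset (Fin n))) (hG : ∀ e ∈ G, e.card = 3)
    (hV : ∀ e ∈ G, e ⊆ V) (i j : Fin n) (hi : i ∈ V) (hj : j ∈ V) (hij : i ≠ j) (x : Fin n → ℝ) (ε : ℝ) :
    pw (sh x i j ε) G = pw x G + ε * (D1 (V \ {i, j}) G j x - D1 (V \ {i, j}) G i x
      + (x i - x j) * D2 (V \ {i, j}) G i j x) - ε ^ 2 * D2 (V \ {i, j}) G i j x := by
  have hc : ∀ k ∈ V \ {i, j}, sh x i j ε k = x k := by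
    intro k hk
    simp only [mem_sdiff, mem_insert, mem_singleton, not_or] at hk
    exact sh_k _ _ _ _ hk.2.1 hk.2.2 _
  rw [pw_expand V G hG hV i j hi hj hij, pw_expand V G hG hV i j hi hj hij x, D1_congr _ _ _ _ _ hc,
    D1_congr _ _ _ _ _ hc, D2_congr _ _ _ _ _ _ hc, sh_j, sh_i _ _ _ hij]
  have : pw (sh x i j ε) (G.filter fun e => i ∉ e ∧ j ∉ e) = pw x (G.filter fun e => i ∉ e ∧ j ∉ e) := by
    rw [pw, pw]
    refine sum_congr rfl fun e he => prod_congr rfl fun k hk => ?_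
    have := (mem_filter.1 he).2
    refine sh_k _ _ _ _ ?_ ?_ _
    · rintro rfl; exact this.1 hk
    · rintro rfl; exact this.2 hk
  rw [this]; ring

lemma sh_legal (x : Fin n → ℝ) (hx : isLegal x) (i j : Fin n) (hij : i ≠ j) (ε : ℝ) (h0 : 0 ≤ ε) (h1 : ε ≤ x i) :
    isLegal (sh x i j ε) := by
  refine ⟨?_, fun k => ?_⟩
  · have hj : j ∈ (univ : Finset (Fin n)) := mem_univ _
    have hi : i ∈ (univ : Finset (Fin n)).erase j := by simp [hij]
    have e1 := hx.1
    rw [← Finset.add_sum_erase _ _ hj, ← Finset.add_sum_erase _ _ hi] at e1 ⊢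
    rw [sh_j, sh_i _ _ _ hij]
    have : ∑ k ∈ (univ.erase j).erase i, sh x i j ε k = ∑ k ∈ (univ.erase j).erase i, x k := by
      refine sum_congr rfl fun k hk => ?_
      simp only [mem_erase] at hk
      exact sh_k _ _ _ _ hk.1 hk.2.1 _
    rw [this]; linarith
  · by_cases hk : k = j
    · subst hk; rw [sh_j]; have := hx.2 k; linarith
    · by_cases hk' : k = i
      · subst hk'; rw [sh_i _ _ _ hij]; linarith
      · rw [sh_k _ _ _ _ hk' hk]; exact hx.2 k

lemma quad_aux (a b c : ℝ) (hc : 0 < c) (h : ∀ ε, 0 ≤ ε → ε ≤ c → ε * a - ε ^ 2 * b ≤ 0) : a ≤ 0 := by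
  by_contra ha
  push Not at ha
  have hb : 0 < 2 * (|b| + 1) := by positivity
  set ε := min c (a / (2 * (|b| + 1))) with hε
  have e0 : 0 < ε := lt_min hc (by positivity)
  have e1 : ε * (2 * (|b| + 1)) ≤ a := (le_div_iff₀ hb).1 (min_le_right _ _)
  have := h ε e0.le (min_le_left _ _)
  have h2 : ε * b ≤ ε * |b| := by gcongr; exact le_abs_self b
  have : 0 < ε * (a - ε * b) := by
    apply mul_pos e0; nlinarith [abs_nonneg b]
  nlinarith

lemma D2_nonneg (R : Finset (Fin n)) (G) (i j : Fin n) (x : Fin n → ℝ) (h : ∀ k, 0 ≤ x k) : 0 ≤ D2 R G i j x := by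
  classical
  rw [D2]; exact sum_nonneg fun k _ => by split_ifs; exacts [h k, le_rfl]

lemma D2_comm (R : Finset (Fin n)) (G) (i j : Fin n) (x : Fin n → ℝ) : D2 R G i j x = D2 R G j i x := by
  classical
  rw [D2, D2]; refine sum_congr rfl fun k _ => by rw [insert_comm]

/-- symmetric function identities -/
lemma two_sig (B : Finset (Fin n)) (x : Fin n → ℝ) :
    2 * ∑ q ∈ powersetCard 2 B, ∏ i ∈ q, x i = (∑ i ∈ B, x i) ^ 2 - ∑ i ∈ B, x i ^ 2 := by
  induction B using Finset.induction_on with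
  | empty => simp [pc_empty2, pc_empty3]
  | insert a s ha ih =>
    rw [spc _ a ha 1, sp1, sum_insert ha, sum_insert ha, mul_add, ih]
    have : ∑ k ∈ s, ∏ i ∈ insert a {k}, x i = x a * ∑ k ∈ s, x k := by
      rw [mul_sum]; refine sum_congr rfl fun k hk => ?_
      rw [prod_insert, prod_singleton]; rw [mem_singleton]; rintro rfl; exact ha hk
    rw [this]; ring

lemma six_sig (B : Finset (Fin n)) (x : Fin n → ℝ) :
    6 * ∑ q ∈ powersetCard 3 B, ∏ i ∈ q, x i = (∑ i ∈ B, x i) ^ 3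
      - 3 * (∑ i ∈ B, x i) * ∑ i ∈ B, x i ^ 2 + 2 * ∑ i ∈ B, x i ^ 3 := by
  induction B using Finset.induction_on with
  | empty => simp [pc_empty2, pc_empty3]
  | insert a s ha ih =>
    rw [spc _ a ha 2, sum_insert ha, sum_insert ha, sum_insert ha, mul_add, ih]
    have : ∑ q ∈ powersetCard 2 s, ∏ i ∈ insert a q, x i = x a * ∑ q ∈ powersetCard 2 s, ∏ i ∈ q, x i := by
      rw [mul_sum]; refine sum_congr rfl fun q hq => ?_
      rw [prod_insert]; exact fun h => ha ((mem_powersetCard.1 hq).1 h)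
    rw [this]
    have := two_sig s x
    linear_combination 3 * x a * this

lemma six_sig_le (B : Finset (Fin n)) (x : Fin n → ℝ) (t : ℕ) (ht : 5 ≤ t) (hB : B.card = t)
    (h1 : ∑ i ∈ B, x i = 1) (h0 : ∀ i, 0 ≤ x i) :
    6 * ∑ q ∈ powersetCard 3 B, ∏ i ∈ q, x i ≤ ((t : ℝ) - 1) * ((t : ℝ) - 2) / (t : ℝ) ^ 2 := by
  have ht' : (5 : ℝ) ≤ t := by exact_mod_cast ht
  set c : ℝ := 1 / t with hc
  have hct : c * t = 1 := by rw [hc]; field_simp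
  have hc0 : 0 < c := by positivity
  have hc5 : c ≤ 1 / 5 := by rw [hc]; gcongr
  have hpt : ∀ i ∈ B, 3 * c ^ 2 - 2 * c ^ 3 + (6 * c - 6 * c ^ 2) * (x i - c) ≤ 3 * x i ^ 2 - 2 * x i ^ 3 := by
    intro i hi
    have hx1 : x i ≤ 1 := h1 ▸ single_le_sum (fun k _ => h0 k) hi
    have : 0 ≤ (x i - c) ^ 2 * (3 - 2 * x i - 4 * c) := mul_nonneg (sq_nonneg _) (by linarith)
    nlinarith
  have := sum_le_sum hpt
  rw [sum_add_distrib, sum_const, hB, ← mul_sum, sum_sub_distrib, sum_sub_distrib, ← mul_sum, ← mul_sum, sum_const, hB, h1] at this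
  simp only [nsmul_eq_mul] at this
  rw [six_sig, h1]
  have e : ((t : ℝ) - 1) * ((t : ℝ) - 2) / (t : ℝ) ^ 2 = 1 - 3 * c + 2 * c ^ 2 := by rw [hc]; field_simp; ring
  rw [e]
  have e2 : (t:ℝ) * (3 * c ^ 2 - 2 * c ^ 3) = 3 * c - 2 * c ^ 2 := by linear_combination (3*c - 2 * c^2) * hct
  have e3 : (t:ℝ) * c = 1 := by linarith
  rw [e2, e3] at this
  linarith


/-- admissible family: contains the clique on S and few further triples -/
def Adm (t : ℕ) (S : Finset (Fin n)) (G : Finset (Finset (Fin n))) : Prop :=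
  (∀ e ∈ G, e.card = 3) ∧ powersetCard 3 S ⊆ G ∧ G.card ≤ Nat.choose S.card 3 + Nat.choose (t - 1) 2

open Classical in
noncomputable def supp (x : Fin n → ℝ) : Finset (Fin n) := univ.filter fun i => x i ≠ 0

lemma mem_supp (x : Fin n → ℝ) (i : Fin n) : i ∈ supp x ↔ x i ≠ 0 := by simp [supp]

lemma pw_replace (x : Fin n → ℝ) (H P Q : Finset (Finset (Fin n))) (hP : P ⊆ H) (hQ : ∀ q ∈ Q, q ∉ H) :
    pw x ((H \ P) ∪ Q) = pw x H - pw x P + pw x Q := by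
  have hd : Disjoint (H \ P) Q := by
    rw [disjoint_left]; intro e he hq; exact hQ e hq (mem_sdiff.1 he).1
  have := sum_sdiff (f := fun e => ∏ i ∈ e, x i) hP
  simp only [pw]
  rw [sum_union hd]; linarith

lemma card_replace (H P Q : Finset (Finset (Fin n))) (hP : P ⊆ H) (hQ : Q.card ≤ P.card) :
    ((H \ P) ∪ Q).card ≤ H.card := by
  have h1 := card_union_le (H \ P) Q
  have h2 := card_sdiff_add_card_eq_card hP
  omega

lemma pw_nonneg (x : Fin n → ℝ) (hx : ∀ i, 0 ≤ x i) (H : Finset (Finset (Fin n))) : 0 ≤ pw x H :=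
  sum_nonneg fun e _ => prod_nonneg fun i _ => hx i

lemma pw_mono (x : Fin n → ℝ) (hx : ∀ i, 0 ≤ x i) (H G : Finset (Finset (Fin n))) (h : H ⊆ G) : pw x H ≤ pw x G :=
  sum_le_sum_of_subset_of_nonneg h fun e _ _ => prod_nonneg fun i _ => hx i

lemma pw_filter (x : Fin n → ℝ) (H : Finset (Finset (Fin n))) :
    pw x (H.filter fun e => e ⊆ supp x) = pw x H := by
  rw [pw, pw, sum_filter]
  refine sum_congr rfl fun e _ => ?_
  split_ifs with h
  · rfl
  · obtain ⟨i, hi, hi'⟩ := not_subset.1 h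
    rw [mem_supp, not_not] at hi'
    exact (prod_eq_zero hi hi').symm

structure Opt (t : ℕ) (A : Finset (Fin n)) (H : Finset (Finset (Fin n))) (x : Fin n → ℝ) : Prop where
  cardA : A.card = t
  adm : Adm t A H
  legal : isLegal x
  hopt : ∀ (A' : Finset (Fin n)) (H' : Finset (Finset (Fin n))) (y : Fin n → ℝ), A'.card = t → Adm t A' H' → isLegal y → pw y H' ≤ pw x H
  hsup : ∀ (A' : Finset (Fin n)) (H' : Finset (Finset (Fin n))) (y : Fin n → ℝ), A'.card = t → Adm t A' H' → isLegal y → pw x H ≤ pw y H' → (supp x).card ≤ (supp y).card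
  hA : ∀ (A' : Finset (Fin n)) (H' : Finset (Finset (Fin n))), A'.card = t → Adm t A' H' → pw x H ≤ pw x H' → ∑ i ∈ A', x i ≤ ∑ i ∈ A, x i

lemma legal_compact : IsCompact {x : Fin n → ℝ | isLegal x} := by
  have : {x : Fin n → ℝ | isLegal x} = stdSimplex ℝ (Fin n) := by
    ext x; simp [isLegal, stdSimplex, and_comm]
  rw [this]; exact isCompact_stdSimplex ℝ (Fin n)

lemma pw_cont (G : Finset (Finset (Fin n))) : Continuous fun x : Fin n → ℝ => pw x G := by
  unfold pw; fun_prop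

lemma exists_opt (t : ℕ) (A₀ : Finset (Fin n)) (H₀) (x₀ : Fin n → ℝ) (hA₀ : A₀.card = t) (hH₀ : Adm t A₀ H₀)
    (hx₀ : isLegal x₀) : ∃ A H x, Opt (n := n) t A H x := by
  classical
  have h1 : ∀ H : Finset (Finset (Fin n)), ∃ y : Fin n → ℝ, isLegal y ∧ ∀ z, isLegal z → pw z H ≤ pw y H := by
    intro H
    obtain ⟨y, hy, hm⟩ := legal_compact.exists_isMaxOn (f := fun x : Fin n → ℝ => pw x H) ⟨x₀, hx₀⟩ (pw_cont H).continuousOn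
    exact ⟨y, hy, fun z hz => hm hz⟩
  choose Y hY1 hY2 using h1
  let T : Finset (Finset (Fin n) × Finset (Finset (Fin n))) := univ.filter fun p => p.1.card = t ∧ Adm t p.1 p.2
  obtain ⟨p, hp, hpm⟩ := exists_max_image T (fun p => pw (Y p.2) p.2) ⟨(A₀, H₀), by simp [T, hA₀, hH₀]⟩
  set M := pw (Y p.2) p.2 with hM
  have hub : ∀ A' H' y, A'.card = t → Adm t A' H' → isLegal y → pw y H' ≤ M := fun A' H' y h1 h2 h3 =>
    (hY2 H' y h3).trans (hpm (A', H') (by simp [T, h1, h2]))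
  have hpT : p.1.card = t ∧ Adm t p.1 p.2 := by simpa [T] using hp
  have hex : ∃ k, ∃ A H x, A.card = t ∧ Adm t A H ∧ isLegal x ∧ M ≤ pw x H ∧ (supp x).card = k :=
    ⟨_, p.1, p.2, Y p.2, hpT.1, hpT.2, hY1 _, le_rfl, rfl⟩
  obtain ⟨A1, H1, x, a1, a2, a3, a4, a5⟩ := Nat.find_spec hex
  let T2 := T.filter fun q => M ≤ pw x q.2
  obtain ⟨q, hq, hqm⟩ := exists_max_image T2 (fun q => ∑ i ∈ q.1, x i) ⟨(A1, H1), by simp [T2, T, a1, a2, a4]⟩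
  have hqT : (q.1.card = t ∧ Adm t q.1 q.2) ∧ M ≤ pw x q.2 := by simpa [T2, T] using hq
  refine ⟨q.1, q.2, x, hqT.1.1, hqT.1.2, a3, fun A' H' y h1 h2 h3 => (hub A' H' y h1 h2 h3).trans hqT.2,
    fun A' H' y h1 h2 h3 h4 => ?_, fun A' H' h1 h2 h3 => ?_⟩
  · rw [a5]; exact Nat.find_min' hex ⟨A', H', y, h1, h2, h3, hqT.2.trans h4, rfl⟩
  · exact hqm (A', H') (by simp [T2, T, h1, h2, hqT.2.trans h3])

lemma Opt.trim {t : ℕ} {A : Finset (Fin n)} {H} {x : Fin n → ℝ} (h : Opt t A H x) (hs : A ⊆ supp x) :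
    Opt t A (H.filter fun e => e ⊆ supp x) x := by
  have e := pw_filter x H
  refine ⟨h.cardA, ⟨fun e he => h.adm.1 e (mem_filter.1 he).1, fun e he => ?_, ?_⟩, h.legal, ?_, ?_, ?_⟩
  · exact mem_filter.2 ⟨h.adm.2.1 he, (mem_powersetCard.1 he).1.trans hs⟩
  · exact (card_filter_le _ _).trans h.adm.2.2
  · rw [e]; exact h.hopt
  · rw [e]; exact h.hsup
  · rw [e]; exact h.hA

lemma insert_inj_on {a : Fin n} {p q : Finset (Fin n)} (hp : a ∉ p) (hq : a ∉ q) (h : insert a p = insert a q) : p = q := by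
  rw [← erase_insert hp, ← erase_insert hq, h]

lemma pw_image_insert (x : Fin n → ℝ) (a : Fin n) (B : Finset (Finset (Fin n))) (hB : ∀ e ∈ B, a ∉ e) :
    pw x (B.image (insert a)) = x a * pw x B := by
  rw [pw, sum_image, pw, mul_sum]
  · exact sum_congr rfl fun e he => prod_insert (hB e he)
  · intro p hp q hq h; exact insert_inj_on (hB p hp) (hB q hq) h

lemma card_image_insert' (a : Fin n) (B : Finset (Finset (Fin n))) (hB : ∀ e ∈ B, a ∉ e) :
    (B.image (insert a)).card = B.card :=
  card_image_of_injOn fun p hp q hq h => insert_inj_on (hB p hp) (hB q hq) h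

lemma Opt.O3 {t : ℕ} {A : Finset (Fin n)} {H} {x : Fin n → ℝ} (h : Opt t A H x) (a v : Fin n) (ha : a ∈ A) (hv : v ∉ A) :
    x v ≤ x a := by
  classical
  by_contra hlt
  push Not at hlt
  have hav : a ≠ v := by rintro rfl; exact hv ha
  let A' := insert v (A.erase a)
  have hvA : v ∉ A.erase a := fun h' => hv (mem_of_mem_erase h')
  have hcA' : A'.card = A.card := by
    rw [card_insert_of_notMem hvA, card_erase_add_one ha]
  let B := (powersetCard 2 (A.erase a)).filter fun e => insert v e ∉ H
  have hBa : ∀ e ∈ B, a ∉ e := fun e he h' => by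
    have := (mem_powersetCard.1 (mem_filter.1 he).1).1 h'
    simp at this
  have hBv : ∀ e ∈ B, v ∉ e := fun e he h' => hvA ((mem_powersetCard.1 (mem_filter.1 he).1).1 h')
  let P := B.image (insert a)
  let Q := B.image (insert v)
  have hP : P ⊆ H := by
    intro e he
    obtain ⟨q, hq, rfl⟩ := mem_image.1 he
    obtain ⟨hq1, hq2⟩ := mem_powersetCard.1 (mem_filter.1 hq).1
    apply h.adm.2.1
    rw [mem_powersetCard, card_insert_of_notMem (hBa q hq), hq2]
    exact ⟨insert_subset ha (hq1.trans (erase_subset _ _)), rfl⟩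
  have hQ : ∀ q ∈ Q, q ∉ H := by
    intro e he
    obtain ⟨q, hq, rfl⟩ := mem_image.1 he
    exact (mem_filter.1 hq).2
  have hPc : P.card = B.card := card_image_insert' a B hBa
  have hQc : Q.card = B.card := card_image_insert' v B hBv
  have hadm : Adm t A' ((H \ P) ∪ Q) := by
    refine ⟨fun e he => ?_, fun e he => ?_, ?_⟩
    · rcases mem_union.1 he with he | he
      · exact h.adm.1 e (mem_sdiff.1 he).1
      · obtain ⟨q, hq, rfl⟩ := mem_image.1 he
        rw [card_insert_of_notMem (hBv q hq), (mem_powersetCard.1 (mem_filter.1 hq).1).2]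
    · obtain ⟨he1, he2⟩ := mem_powersetCard.1 he
      have hae : a ∉ e := by
        intro h'
        have := he1 h'
        simp [A', hav] at this
      have haP : e ∉ P := by
        intro h'
        obtain ⟨q, hq, rfl⟩ := mem_image.1 h'
        exact hae (mem_insert_self _ _)
      rw [mem_union, mem_sdiff]
      by_cases heH : e ∈ H
      · exact Or.inl ⟨heH, haP⟩
      · right
        by_cases hve : v ∈ e
        · refine mem_image.2 ⟨e.erase v, ?_, insert_erase hve⟩
          rw [mem_filter, insert_erase hve, mem_powersetCard, card_erase_of_mem hve, he2]
          refine ⟨⟨?_, rfl⟩, heH⟩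
          rw [← subset_insert_iff]; exact he1
        · exfalso
          apply heH; apply h.adm.2.1
          rw [mem_powersetCard]
          exact ⟨((subset_insert_iff_of_notMem hve).1 he1).trans (erase_subset _ _), he2⟩
    · rw [hcA']
      exact (card_replace H P Q hP (by omega)).trans h.adm.2.2
  have hval : pw x H ≤ pw x ((H \ P) ∪ Q) := by
    rw [pw_replace x H P Q hP hQ, pw_image_insert x a B hBa, pw_image_insert x v B hBv]
    have := pw_nonneg x h.legal.2 B
    nlinarith
  have := h.hA A' _ (hcA'.trans h.cardA) hadm hval
  rw [sum_insert hvA, ← add_sum_erase _ _ ha] at this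
  linarith

/-- stationarity -/
lemma Opt.stat {t : ℕ} {A : Finset (Fin n)} {H} {x : Fin n → ℝ} (h : Opt t A H x) (hV : ∀ e ∈ H, e ⊆ supp x)
    (i j : Fin n) (hi : i ∈ supp x) (hj : j ∈ supp x) (hij : i ≠ j) :
    (x i - x j) * D2 (supp x \ {i, j}) H i j x = D1 (supp x \ {i, j}) H i x - D1 (supp x \ {i, j}) H j x := by
  have key : ∀ i j : Fin n, i ∈ supp x → j ∈ supp x → i ≠ j → D1 (supp x \ {i, j}) H j x - D1 (supp x \ {i, j}) H i x
      + (x i - x j) * D2 (supp x \ {i, j}) H i j x ≤ 0 := by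
    intro i j hi hj hij
    have hx : 0 < x i := lt_of_le_of_ne (h.legal.2 i) (Ne.symm ((mem_supp x i).1 hi))
    refine quad_aux _ (D2 (supp x \ {i, j}) H i j x) (x i) hx fun ε h0 h1 => ?_
    have := h.hopt A H _ h.cardA h.adm (sh_legal x h.legal i j hij ε h0 h1)
    rw [pw_shift (supp x) H h.adm.1 hV i j hi hj hij] at this
    linarith
  have h1 := key i j hi hj hij
  have h2 := key j i hj hi hij.symm
  rw [pair_comm j i, D2_comm _ _ j i] at h2
  linarith

lemma supp_sh (x : Fin n → ℝ) (i j : Fin n) (hij : i ≠ j) (hi : i ∈ supp x) (hj : j ∈ supp x) :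
    (supp (sh x i j (x i))).card < (supp x).card := by
  apply card_lt_card
  rw [ssubset_iff_of_subset]
  · exact ⟨i, hi, by rw [mem_supp, sh_i _ _ _ hij]; simp⟩
  · intro k hk
    by_cases h1 : k = i
    · subst h1; exact hi
    · by_cases h2 : k = j
      · subst h2; exact hj
      · rw [mem_supp, sh_k _ _ _ _ h1 h2] at hk; exact (mem_supp _ _).2 hk

lemma Opt.cover {t : ℕ} {A : Finset (Fin n)} {H} {x : Fin n → ℝ} (h : Opt t A H x) (hV : ∀ e ∈ H, e ⊆ supp x)
    (i j : Fin n) (hi : i ∈ supp x) (hj : j ∈ supp x) (hij : i ≠ j) :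
    ∃ k ∈ supp x \ {i, j}, insert i (insert j {k}) ∈ H := by
  classical
  by_contra hno
  push Not at hno
  have h0 : D2 (supp x \ {i, j}) H i j x = 0 := by
    rw [D2]; exact sum_eq_zero fun k hk => by rw [if_neg (hno k hk)]
  have hs := h.stat hV i j hi hj hij
  have h1 := pw_shift (supp x) H h.adm.1 hV i j hi hj hij x (x i)
  rw [h0] at h1 hs
  have e : D1 (supp x \ {i, j}) H j x = D1 (supp x \ {i, j}) H i x := by linarith
  have := h.hsup A H _ h.cardA h.adm (sh_legal x h.legal i j hij (x i) (h.legal.2 i) le_rfl) (by rw [h1, e]; simp)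
  have := supp_sh x i j hij hi hj
  omega

lemma D1_union (X Y : Finset (Fin n)) (hd : Disjoint X Y) (H) (i : Fin n) (x : Fin n → ℝ) :
    D1 (X ∪ Y) H i x = D1 X H i x + D1 Y H i x + ∑ a ∈ X, x a * D2 Y H i a x := by
  classical
  rw [D1, sp2_union X Y hd, D1, D1]
  congr 1
  refine sum_congr rfl fun a ha => ?_
  rw [D2, mul_sum]
  refine sum_congr rfl fun b hb => ?_
  have hab : a ≠ b := by rintro rfl; exact disjoint_left.1 hd ha hb
  rw [prod_pair hab]; split_ifs <;> simp

lemma D1_insert (B : Finset (Fin n)) (v : Fin n) (hv : v ∉ B) (H) (i : Fin n) (x : Fin n → ℝ) :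
    D1 (insert v B) H i x = D1 B H i x + x v * D2 B H i v x := by
  classical
  rw [insert_eq, D1_union _ _ (by simpa using hv)]
  have : D1 {v} H i x = 0 := by
    rw [D1, powersetCard_eq_empty.2 (by simp)]; simp
  rw [this]; simp

lemma D1_full (B : Finset (Fin n)) (H) (i : Fin n) (x : Fin n → ℝ) (h : ∀ q ∈ powersetCard 2 B, insert i q ∈ H) :
    D1 B H i x = ∑ q ∈ powersetCard 2 B, ∏ k ∈ q, x k := by
  classical
  rw [D1]; exact sum_congr rfl fun q hq => if_pos (h q hq)

lemma D2_full (B : Finset (Fin n)) (H) (i j : Fin n) (x : Fin n → ℝ) (h : ∀ k ∈ B, insert i (insert j {k}) ∈ H) :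
    D2 B H i j x = ∑ k ∈ B, x k := by
  classical
  rw [D2]; exact sum_congr rfl fun q hq => if_pos (h q hq)

lemma D2_le (B : Finset (Fin n)) (H) (i j : Fin n) (x : Fin n → ℝ) (hx : ∀ k, 0 ≤ x k) :
    D2 B H i j x ≤ ∑ k ∈ B, x k := by
  classical
  rw [D2]; exact sum_le_sum fun k _ => by split_ifs; exacts [le_rfl, hx k]

lemma D2_ge (B : Finset (Fin n)) (H) (i j k : Fin n) (x : Fin n → ℝ) (hx : ∀ k, 0 ≤ x k) (hk : k ∈ B)
    (h : insert i (insert j {k}) ∈ H) : x k ≤ D2 B H i j x := by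
  classical
  rw [D2]
  have := single_le_sum (f := fun k => if insert i (insert j {k}) ∈ H then x k else 0) (s := B)
    (fun l _ => by split_ifs; exacts [hx l, le_rfl]) hk
  simpa [h] using this

lemma triple_mem {A : Finset (Fin n)} {H : Finset (Finset (Fin n))} (hH : powersetCard 3 A ⊆ H) (i j k : Fin n)
    (hi : i ∈ A) (hj : j ∈ A) (hk : k ∈ A) (hij : i ≠ j) (hik : i ≠ k) (hjk : j ≠ k) :
    insert i (insert j {k}) ∈ H := by
  apply hH
  rw [mem_powersetCard]
  refine ⟨?_, card_eq_three.2 ⟨i, j, k, hij, hik, hjk, rfl⟩⟩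
  intro l hl
  simp only [mem_insert, mem_singleton] at hl
  rcases hl with rfl | rfl | rfl <;> assumption

lemma ins_mem {A : Finset (Fin n)} {H : Finset (Finset (Fin n))} (hH : powersetCard 3 A ⊆ H) (i : Fin n) (B q : Finset (Fin n))
    (hi : i ∈ A) (hB : B ⊆ A) (hiB : i ∉ B) (hq : q ∈ powersetCard 2 B) :
    insert i q ∈ H := by
  apply hH
  obtain ⟨h1, h2⟩ := mem_powersetCard.1 hq
  rw [mem_powersetCard, card_insert_of_notMem (fun h => hiB (h1 h)), h2]
  exact ⟨insert_subset hi (h1.trans hB), rfl⟩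

lemma Opt.pos {t : ℕ} {A : Finset (Fin n)} {H} {x : Fin n → ℝ} (h : Opt t A H x) (k : Fin n) (hk : k ∈ supp x) : 0 < x k :=
  lt_of_le_of_ne (h.legal.2 k) (Ne.symm ((mem_supp x k).1 hk))

lemma Opt.u1 {t : ℕ} {A : Finset (Fin n)} {H} {x : Fin n → ℝ} (h : Opt t A H x) (hV : ∀ e ∈ H, e ⊆ supp x)
    (ht : 5 ≤ t) (v : Fin n) (hv : v ∉ A) (hs : supp x = insert v A) : False := by
  classical
  have hne : A.Nonempty := by rw [← card_pos, h.cardA]; omega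
  have hvs : v ∈ supp x := by rw [hs]; simp
  have hAs : ∀ k ∈ A, k ∈ supp x := fun k hk => by rw [hs]; simp [hk]
  obtain ⟨t0, ht0, hmin⟩ := exists_min_image A x hne
  obtain ⟨b, hb, hmax⟩ := exists_max_image A x hne
  have hvp := h.pos v hvs
  have hmv : x v ≤ x t0 := h.O3 t0 v ht0 hv
  have ht0v : t0 ≠ v := by rintro rfl; exact hv ht0
  have st := h.stat hV t0 v (hAs t0 ht0) hvs ht0v
  obtain ⟨k0, hk0, hk0H⟩ := h.cover hV t0 v (hAs t0 ht0) hvs ht0v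
  have hRe : supp x \ {t0, v} = A.erase t0 := by
    ext k; simp only [hs, mem_sdiff, mem_insert, mem_singleton, mem_erase]
    constructor
    · rintro ⟨h1, h2⟩; tauto
    · rintro ⟨h1, h2⟩; refine ⟨Or.inr h2, ?_⟩; rintro (h3 | rfl) <;> contradiction
  rw [hRe] at st hk0
  set R := A.erase t0 with hR
  have hRA : R ⊆ A := erase_subset _ _
  have hvR : v ∉ R := fun h' => hv (hRA h')
  have ht0R : t0 ∉ R := by simp [hR]
  have hRc : R.card = t - 1 := by rw [hR, card_erase_of_mem ht0, h.cardA]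
  set J := R.filter fun k => insert t0 (insert v {k}) ∈ H with hJ
  set M := (powersetCard 2 R).filter fun q => insert v q ∉ H with hM
  have hJne : 1 ≤ J.card := card_pos.2 ⟨k0, mem_filter.2 ⟨hk0, hk0H⟩⟩
  -- counting
  have hcount : J.card ≤ M.card := by
    let M' := (powersetCard 2 R).filter fun q => insert v q ∈ H
    have hMM : M'.card + M.card = Nat.choose (t - 1) 2 := by
      rw [← hRc, ← card_powersetCard]; exact card_filter_add_card_filter_not _
    have hM'v : ∀ e ∈ M', v ∉ e := fun e he h' => hvR ((mem_powersetCard.1 (mem_filter.1 he).1).1 h')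
    let I1 := M'.image (insert v)
    let I2 := J.image fun k => insert t0 (insert v ({k} : Finset (Fin n)))
    have c1 : I1.card = M'.card := card_image_insert' v M' hM'v
    have c2 : I2.card = J.card := by
      apply card_image_of_injOn
      intro k hk l hl hkl
      have hk' : k ∈ R := (mem_filter.1 hk).1
      have : k ∈ insert t0 (insert v ({l} : Finset (Fin n))) := by
        have hkl' : insert t0 (insert v ({k} : Finset (Fin n))) = insert t0 (insert v {l}) := hkl
        rw [← hkl']; simp
      simp only [mem_insert, mem_singleton] at this
      rcases this with rfl | rfl | rfl
      · exact absurd hk' ht0R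
      · exact absurd hk' hvR
      · rfl
    have hsub : powersetCard 3 A ∪ (I1 ∪ I2) ⊆ H := by
      refine union_subset h.adm.2.1 (union_subset ?_ ?_)
      · intro e he; obtain ⟨q, hq, rfl⟩ := mem_image.1 he; exact (mem_filter.1 hq).2
      · intro e he; obtain ⟨q, hq, rfl⟩ := mem_image.1 he; exact (mem_filter.1 hq).2
    have d1 : Disjoint I1 I2 := by
      rw [disjoint_left]; intro e h1 h2
      obtain ⟨q, hq, rfl⟩ := mem_image.1 h1
      obtain ⟨k, hk, hk2⟩ := mem_image.1 h2
      have : t0 ∈ insert v q := by rw [← hk2]; simp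
      rcases mem_insert.1 this with h3 | h3
      · exact ht0v h3
      · exact ht0R ((mem_powersetCard.1 (mem_filter.1 hq).1).1 h3)
    have d2 : Disjoint (powersetCard 3 A) (I1 ∪ I2) := by
      rw [disjoint_left]; intro e h1 h2
      have hve : v ∈ e := by
        rcases mem_union.1 h2 with h2 | h2
        · obtain ⟨q, hq, rfl⟩ := mem_image.1 h2; simp
        · obtain ⟨q, hq, rfl⟩ := mem_image.1 h2; simp
      exact hv ((mem_powersetCard.1 h1).1 hve)
    have := card_le_card hsub
    rw [card_union_of_disjoint d2, card_union_of_disjoint d1, c1, c2, card_powersetCard] at this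
    have := h.adm.2.2
    omega
  have eD2 : D2 R H t0 v x = ∑ k ∈ J, x k := by rw [D2, hJ, sum_filter]
  have eD1 : D1 R H t0 x - D1 R H v x = ∑ q ∈ M, ∏ k ∈ q, x k := by
    rw [D1_full R H t0 x fun q hq => ins_mem h.adm.2.1 t0 R q ht0 hRA ht0R hq, D1, hM, sum_filter, ← sum_sub_distrib]
    refine sum_congr rfl fun q _ => ?_
    by_cases hq : insert v q ∈ H <;> simp [hq]
  rw [eD2, eD1] at st
  have hxb : x t0 ≤ x b := hmax t0 ht0
  have hex : ∃ q ∈ M, ∏ k ∈ q, x k ≤ (x t0 - x v) * x b := by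
    by_contra hno
    push Not at hno
    have hMne : M.Nonempty := card_pos.1 (by omega)
    have h1 := sum_lt_sum_of_nonempty hMne hno
    rw [sum_const, nsmul_eq_mul, ← st] at h1
    have h2 : ∑ k ∈ J, x k ≤ J.card * x b := by
      rw [← nsmul_eq_mul]; exact sum_le_card_nsmul _ _ _ fun k hk => hmax k (hRA (mem_filter.1 hk).1)
    have h3 : (J.card : ℝ) ≤ M.card := by exact_mod_cast hcount
    have h4 : 0 ≤ (x t0 - x v) * x b := mul_nonneg (by linarith) (h.legal.2 b)
    have h5 : (x t0 - x v) * ∑ k ∈ J, x k ≤ (x t0 - x v) * (J.card * x b) :=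
      mul_le_mul_of_nonneg_left h2 (by linarith)
    have h6 := mul_le_mul_of_nonneg_right h3 h4
    linarith
  obtain ⟨q, hq, hqle⟩ := hex
  obtain ⟨hq1, hq2⟩ := mem_powersetCard.1 (mem_filter.1 hq).1
  obtain ⟨i, l, hil, rfl⟩ := card_eq_two.1 hq2
  rw [prod_pair hil] at hqle
  have hiA : i ∈ A := hRA (hq1 (by simp))
  have hlA : l ∈ A := hRA (hq1 (by simp))
  have hxi := hmin i hiA
  have hlp := h.pos l (hAs l hlA)
  have htp := h.pos t0 (hAs t0 ht0)
  have hgap : x v ≤ x b - x l := by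
    have h1 : x t0 * x l ≤ (x t0 - x v) * x b := (mul_le_mul_of_nonneg_right hxi hlp.le).trans hqle
    have h2 : x v * x t0 ≤ x v * x b := mul_le_mul_of_nonneg_left hxb hvp.le
    have h3 : x t0 * x v ≤ x t0 * (x b - x l) := by linarith
    exact le_of_mul_le_mul_left h3 htp
  have hbl : b ≠ l := by rintro rfl; linarith
  have st2 := h.stat hV b l (hAs b hb) (hAs l hlA) hbl
  have hlv : l ≠ v := by rintro rfl; exact hv hlA
  have hbv : b ≠ v := by rintro rfl; exact hv hb
  set B := A \ {b, l} with hB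
  have hvB : v ∉ B := by simp [hB, hv]
  have hBA : B ⊆ A := sdiff_subset
  have hbB : b ∉ B := by simp [hB]
  have hlB : l ∉ B := by simp [hB]
  have hRe2 : supp x \ {b, l} = insert v B := by
    rw [hs, hB, insert_sdiff_of_notMem]; simp [hbv.symm, hlv.symm]
  rw [hRe2, D1_insert B v hvB, D1_insert B v hvB,
    D1_full B H b x fun q hq => ins_mem h.adm.2.1 b B q hb hBA hbB hq,
    D1_full B H l x fun q hq => ins_mem h.adm.2.1 l B q hlA hBA hlB hq] at st2
  have hfull : D2 B H b l x = ∑ k ∈ B, x k := D2_full _ _ _ _ _ fun k hk =>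
    triple_mem h.adm.2.1 b l k hb hlA (hBA hk) hbl (by rintro rfl; exact hbB hk) (by rintro rfl; exact hlB hk)
  have hY : 0 ≤ ∑ k ∈ B, x k := sum_nonneg fun k _ => h.legal.2 k
  have hbv2 := D2_le B H b v x h.legal.2
  have hsplit : D2 (insert v B) H b l x = (if insert b (insert l {v}) ∈ H then x v else 0) + ∑ k ∈ B, x k := by
    rw [← hfull, D2, sum_insert hvB, D2]
  rw [hsplit] at st2
  by_cases hblv : insert b (insert l {v}) ∈ H
  · rw [if_pos hblv] at st2
    have := D2_nonneg B H l v x h.legal.2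
    have h1 : x v * (x v + ∑ k ∈ B, x k) ≤ (x b - x l) * (x v + ∑ k ∈ B, x k) :=
      mul_le_mul_of_nonneg_right hgap (by linarith)
    have h2 := mul_le_mul_of_nonneg_left hbv2 hvp.le
    have h3 := mul_nonneg hvp.le this
    nlinarith [mul_pos hvp hvp]
  · rw [if_neg hblv] at st2
    obtain ⟨k, hk, hkH⟩ := h.cover hV l v (hAs l hlA) hvs hlv
    have hkB : k ∈ B := by
      simp only [hs, mem_sdiff, mem_insert, mem_singleton, not_or] at hk
      simp only [hB, mem_sdiff, mem_insert, mem_singleton, not_or]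
      refine ⟨hk.1.resolve_left hk.2.2, ?_, hk.2.1⟩
      rintro rfl
      apply hblv
      convert hkH using 1
      ext a; simp only [mem_insert, mem_singleton]; tauto
    have h0 := D2_ge B H l v k x h.legal.2 hkB hkH
    have hkp := h.pos k (hAs k (hBA hkB))
    have h1 : x v * (∑ k ∈ B, x k) ≤ (x b - x l) * (∑ k ∈ B, x k) :=
      mul_le_mul_of_nonneg_right hgap hY
    have h2 := mul_le_mul_of_nonneg_left hbv2 hvp.le
    have h3 : 0 < x v * D2 B H l v x := mul_pos hvp (by linarith)
    nlinarith

lemma cover_count {t : ℕ} {A : Finset (Fin n)} {H} {x : Fin n → ℝ} (h : Opt t A H x) (hV : ∀ e ∈ H, e ⊆ supp x)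
    (ht : 5 ≤ t) (hAs : A ⊆ supp x) (b : Fin n) (hb : b ∈ A) :
    ((H \ powersetCard 3 A).filter fun e => b ∈ e).card + (supp x \ A).card * (t - 1) ≤ (t - 1) * (t - 2) := by
  classical
  set U := supp x \ A with hU
  set F := H \ powersetCard 3 A with hF
  have hFc : F.card ≤ Nat.choose (t - 1) 2 := by
    have h1 := card_sdiff_add_card_eq_card h.adm.2.1
    rw [card_powersetCard, ← hF] at h1
    have := h.adm.2.2
    omega
  have hch : 2 * Nat.choose (t - 1) 2 = (t - 1) * (t - 2) := by
    obtain ⟨k, rfl⟩ : ∃ k, t = k + 2 := ⟨t - 2, by omega⟩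
    have h1 := Nat.triangle_succ k
    have h2 : (k+1).choose 2 = (k+1) * k / 2 := Nat.choose_two_right _
    have h3 : 2 ∣ (k+1) * k := by rw [mul_comm]; exact (Nat.even_mul_succ_self k).two_dvd
    show 2 * (k+1).choose 2 = (k+1) * k
    rw [h2, Nat.mul_div_cancel' h3]
  have hsub : U ×ˢ (A.erase b) ⊆ F.biUnion fun e => (e ∩ U) ×ˢ (e ∩ A.erase b) := by
    rintro ⟨v, a⟩ hva
    obtain ⟨hv, ha⟩ := mem_product.1 hva
    have hv' := mem_sdiff.1 hv
    have haA := mem_of_mem_erase ha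
    have hne : v ≠ a := by rintro rfl; exact hv'.2 haA
    obtain ⟨k, hk, hkH⟩ := h.cover hV v a hv'.1 (hAs haA) hne
    refine mem_biUnion.2 ⟨_, mem_sdiff.2 ⟨hkH, ?_⟩, ?_⟩
    · intro h'; exact hv'.2 ((mem_powersetCard.1 h').1 (mem_insert_self _ _))
    · rw [mem_product]; exact ⟨mem_inter.2 ⟨by simp, hv⟩, mem_inter.2 ⟨by simp, ha⟩⟩
  have h1 := (card_le_card hsub).trans card_biUnion_le
  rw [card_product, card_erase_of_mem hb, h.cardA] at h1
  have h2 : ∀ e ∈ F, ((e ∩ U) ×ˢ (e ∩ A.erase b)).card + (if b ∈ e then 1 else 0) ≤ 2 := by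
    intro e he
    have he3 : e.card = 3 := h.adm.1 e (mem_sdiff.1 he).1
    have hd : Disjoint (e ∩ U) (e ∩ A.erase b) := by
      rw [disjoint_left]; intro k h1 h2
      exact (mem_sdiff.1 (mem_inter.1 h1).2).2 (mem_of_mem_erase (mem_inter.1 h2).2)
    have hc := card_union_of_disjoint hd
    rw [card_product]
    split_ifs with hbe
    · have : (e ∩ U) ∪ (e ∩ A.erase b) ⊆ e.erase b := by
        intro k hk
        rw [mem_erase]
        rcases mem_union.1 hk with hk1 | hk1
        · refine ⟨?_, (mem_inter.1 hk1).1⟩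
          rintro rfl; exact (mem_sdiff.1 (mem_inter.1 hk1).2).2 hb
        · exact ⟨ne_of_mem_erase (mem_inter.1 hk1).2, (mem_inter.1 hk1).1⟩
      have := card_le_card this
      rw [card_erase_of_mem hbe, he3, hc] at this
      generalize (e ∩ U).card = p at *
      generalize (e ∩ A.erase b).card = q at *
      have hp : p ≤ 2 := by omega
      interval_cases p <;> omega
    · have : (e ∩ U) ∪ (e ∩ A.erase b) ⊆ e := union_subset inter_subset_left inter_subset_left
      have := card_le_card this
      rw [he3, hc] at this
      generalize (e ∩ U).card = p at *
      generalize (e ∩ A.erase b).card = q at *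
      have hp : p ≤ 3 := by omega
      interval_cases p <;> omega
  have h3 := sum_le_sum h2
  rw [sum_add_distrib, sum_const, smul_eq_mul, ← card_filter] at h3
  omega

lemma heavy_arith (t u : ℕ) (ht : 5 ≤ t) (hu : 1 ≤ u) (g : ℕ) (hg : 1 ≤ g) (hgu : g + u * (t - 1) ≤ (t - 1) * (t - 2))
    (kk m Y : ℝ) (hm : 0 < m) (hkg : kk ≤ g) (hku : kk ≤ u * (t - 2) + u * (u - 1) / 2) (hY : (t - 2) * m ≤ Y) :
    2 * ((kk - u * (t - 2)) * m) ≤ (t - 3 - u) * Y := by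
  obtain ⟨k, rfl⟩ : ∃ k, t = k + 2 := ⟨t - 2, by omega⟩
  have e1 : k + 2 - 1 = k + 1 := by omega
  have e2 : k + 2 - 2 = k := by omega
  rw [e1, e2] at hgu
  have hk3 : 3 ≤ k := by omega
  have huk : u + 1 ≤ k := by
    by_contra hc
    have : k ≤ u := by omega
    have : k * (k+1) ≤ u * (k+1) := Nat.mul_le_mul_right _ this
    have : (k+1) * k = k * (k+1) := Nat.mul_comm _ _
    omega
  push_cast at *
  have huk' : (u:ℝ) + 1 ≤ k := by exact_mod_cast huk
  have hgu' : (g:ℝ) + u * (k + 1) ≤ (k+1) * k := by exact_mod_cast hgu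
  have hu' : (1:ℝ) ≤ u := by exact_mod_cast hu
  have hk' : (3:ℝ) ≤ k := by exact_mod_cast hk3
  have hY0 : 0 ≤ Y := le_trans (by apply mul_nonneg <;> linarith) hY
  by_cases hr : kk - u * (k + 2 - 2) ≤ 0
  · have h1 : (kk - u * ((k:ℝ) + 2 - 2)) * m ≤ 0 := mul_nonpos_of_nonpos_of_nonneg hr hm.le
    have h2 : 0 ≤ ((k:ℝ) + 2 - 3 - u) * Y := mul_nonneg (by linarith) hY0
    linarith
  · push Not at hr
    have h2u : 2 * u ≤ k := by
      by_contra hc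
      have : (k:ℝ) + 1 ≤ 2 * u := by exact_mod_cast (by omega : k + 1 ≤ 2 * u)
      nlinarith
    have h2u' : 2 * (u:ℝ) ≤ k := by exact_mod_cast h2u
    have h3 : 2 * (kk - u * ((k:ℝ) + 2 - 2)) ≤ (k + 2 - 3 - u) * k := by
      have : (u:ℝ) * (u - 1) ≤ (k + 2 - 3 - u) * k := by nlinarith
      linarith
    have h4 : (((k:ℝ) + 2 - 3 - u) * k) * m ≤ (k + 2 - 3 - u) * Y := by
      rw [mul_assoc]; apply mul_le_mul_of_nonneg_left _ (by linarith); linarith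
    have h5 := mul_le_mul_of_nonneg_right h3 hm.le
    linarith

lemma D2_mono (R S : Finset (Fin n)) (hRS : R ⊆ S) (H) (i j : Fin n) (x : Fin n → ℝ) (hx : ∀ k, 0 ≤ x k) :
    D2 R H i j x ≤ D2 S H i j x := by
  classical
  rw [D2, D2]
  exact sum_le_sum_of_subset_of_nonneg hRS fun k _ _ => by split_ifs; exacts [hx k, le_rfl]

lemma D1_nonneg (R : Finset (Fin n)) (H) (i : Fin n) (x : Fin n → ℝ) (hx : ∀ k, 0 ≤ x k) : 0 ≤ D1 R H i x := by
  classical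
  rw [D1]
  exact sum_nonneg fun q _ => by split_ifs; exacts [prod_nonneg fun k _ => hx k, le_rfl]

lemma Opt.heavy {t : ℕ} {A : Finset (Fin n)} {H} {x : Fin n → ℝ} (h : Opt t A H x) (hV : ∀ e ∈ H, e ⊆ supp x)
    (ht : 5 ≤ t) (hAs : A ⊆ supp x) (hu : 1 ≤ (supp x \ A).card) (t0 b : Fin n) (ht0 : t0 ∈ A) (hb : b ∈ A)
    (hmin : ∀ k ∈ A, x t0 ≤ x k) (hmax : ∀ k ∈ A, x k ≤ x b) :
    2 * x b ≤ x t0 * (t + (supp x \ A).card - 1) := by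
  classical
  have hc := cover_count h hV ht hAs b hb
  set U := supp x \ A with hU
  set m := x t0 with hm
  have hmp : 0 < m := h.pos t0 (hAs ht0)
  have ht' : (5 : ℝ) ≤ t := by exact_mod_cast ht
  have hu' : (1 : ℝ) ≤ U.card := by exact_mod_cast hu
  by_cases hbt : b = t0
  · rw [hbt]
    have : m * 2 ≤ m * (t + U.card - 1) := mul_le_mul_of_nonneg_left (by linarith) hmp.le
    linarith
  have st := h.stat hV b t0 (hAs hb) (hAs ht0) hbt
  set B := A \ {b, t0} with hB
  have hBA : B ⊆ A := sdiff_subset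
  have hbB : b ∉ B := by simp [hB]
  have htB : t0 ∉ B := by simp [hB]
  have hBU : Disjoint B U := by
    rw [disjoint_left]; intro k h1 h2; exact (mem_sdiff.1 h2).2 (hBA h1)
  have hBc : B.card = t - 2 := by
    rw [hB, card_sdiff_of_subset (by intro k; simp only [mem_insert, mem_singleton]; rintro (rfl | rfl) <;> assumption),
      card_pair hbt, h.cardA]
  have hbU : b ∉ U := fun h' => (mem_sdiff.1 h').2 hb
  have hRe : supp x \ {b, t0} = B ∪ U := by
    ext k
    simp only [hB, hU, mem_sdiff, mem_union, mem_insert, mem_singleton]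
    constructor
    · rintro ⟨h1, h2⟩; by_cases hk : k ∈ A <;> tauto
    · rintro (⟨h1, h2⟩ | ⟨h1, h2⟩)
      · exact ⟨hAs h1, h2⟩
      · refine ⟨h1, ?_⟩; rintro (rfl | rfl) <;> contradiction
  rw [hRe, D1_union B U hBU, D1_union B U hBU,
    D1_full B H b x fun q hq => ins_mem h.adm.2.1 b B q hb hBA hbB hq,
    D1_full B H t0 x fun q hq => ins_mem h.adm.2.1 t0 B q ht0 hBA htB hq] at st
  set Y := ∑ k ∈ B, x k with hY
  have hfull : D2 B H b t0 x = Y := D2_full _ _ _ _ _ fun k hk =>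
    triple_mem h.adm.2.1 b t0 k hb ht0 (hBA hk) hbt (by rintro rfl; exact hbB hk) (by rintro rfl; exact htB hk)
  have hD2 : Y ≤ D2 (B ∪ U) H b t0 x := hfull ▸ D2_mono _ _ subset_union_left _ _ _ _ h.legal.2
  have hDt1 := D1_nonneg U H t0 x h.legal.2
  have hDt2 : 0 ≤ ∑ a ∈ B, x a * D2 U H t0 a x :=
    sum_nonneg fun a _ => mul_nonneg (h.legal.2 a) (D2_nonneg _ _ _ _ _ h.legal.2)
  have hUm : ∀ k ∈ U, x k ≤ m := fun k hk => h.O3 t0 k ht0 (mem_sdiff.1 hk).2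
  have hYm : ((t:ℝ) - 2) * m ≤ Y := by
    have := card_nsmul_le_sum B x m fun k hk => hmin k (hBA hk)
    rw [hBc, nsmul_eq_mul, Nat.cast_sub (by omega)] at this
    exact_mod_cast this
  have hYp : 0 < Y := lt_of_lt_of_le (mul_pos (by linarith) hmp) hYm
  -- counting sums
  set K2 : ℝ := ∑ q ∈ powersetCard 2 U, (if insert b q ∈ H then (1:ℝ) else 0) with hK2
  let ka : Fin n → ℝ := fun a => ∑ v ∈ U, (if insert b (insert a {v}) ∈ H then (1:ℝ) else 0)
  have hka : ∀ a, ka a ≤ U.card := by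
    intro a
    have : ∀ v ∈ U, (if insert b (insert a {v}) ∈ H then (1:ℝ) else 0) ≤ 1 := fun v _ => by split_ifs <;> norm_num
    have := sum_le_card_nsmul U _ 1 this
    rw [nsmul_eq_mul, mul_one] at this
    exact this
  have hD1U : D1 U H b x ≤ K2 * m ^ 2 := by
    rw [D1, hK2, sum_mul]
    refine sum_le_sum fun q hq => ?_
    obtain ⟨hq1, hq2⟩ := mem_powersetCard.1 hq
    obtain ⟨i, l, hil, rfl⟩ := card_eq_two.1 hq2
    split_ifs
    · rw [prod_pair hil, one_mul, pow_two]
      exact mul_le_mul (hUm i (hq1 (by simp))) (hUm l (hq1 (by simp))) (h.legal.2 _) hmp.le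
    · simp
  have hD2a : ∀ a ∈ B, x a * D2 U H b a x ≤ m * (U.card * x a - m * (U.card - ka a)) := by
    intro a ha
    have h1 : D2 U H b a x ≤ ka a * m := by
      rw [D2, sum_mul]
      refine sum_le_sum fun v hv => ?_
      split_ifs
      · rw [one_mul]; exact hUm v hv
      · simp
    have h2 := mul_le_mul_of_nonneg_left h1 (h.legal.2 a)
    have h3 : m * (U.card - ka a) ≤ x a * (U.card - ka a) :=
      mul_le_mul_of_nonneg_right (hmin a (hBA ha)) (by linarith [hka a])
    nlinarith
  have hsum := sum_le_sum hD2a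
  rw [← mul_sum, sum_sub_distrib, ← mul_sum, ← mul_sum, sum_sub_distrib, sum_const, hBc, nsmul_eq_mul, Nat.cast_sub (by omega)] at hsum
  set K1 := ∑ a ∈ B, ka a with hK1
  have hK1u : K1 ≤ U.card * (t - 2) := by
    have := sum_le_card_nsmul B ka U.card fun a _ => hka a
    rw [hBc, nsmul_eq_mul, Nat.cast_sub (by omega)] at this
    push_cast at this; linarith
  have hK2u : K2 ≤ U.card * (U.card - 1) / 2 := by
    have : ∀ q ∈ powersetCard 2 U, (if insert b q ∈ H then (1:ℝ) else 0) ≤ 1 := fun v _ => by split_ifs <;> norm_num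
    have := sum_le_card_nsmul _ _ 1 this
    rw [card_powersetCard, nsmul_eq_mul, mul_one, Nat.cast_choose_two] at this
    exact this
  set g := ((H \ powersetCard 3 A).filter fun e => b ∈ e).card with hg
  have hKg : K1 + K2 ≤ g := by
    set K := (powersetCard 2 (B ∪ U)).filter fun q => insert b q ∈ H ∧ ¬ q ⊆ B with hK
    have e1 : (K.card : ℝ) = K1 + K2 := by
      rw [hK, card_filter]
      push_cast
      rw [sp2_union B U hBU]
      have z1 : ∑ q ∈ powersetCard 2 B, (if insert b q ∈ H ∧ ¬ q ⊆ B then (1:ℝ) else 0) = 0 :=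
        sum_eq_zero fun q hq => if_neg fun hh => hh.2 (mem_powersetCard.1 hq).1
      have z2 : ∑ q ∈ powersetCard 2 U, (if insert b q ∈ H ∧ ¬ q ⊆ B then (1:ℝ) else 0) = K2 := by
        refine sum_congr rfl fun q hq => ?_
        have : ¬ q ⊆ B := by
          intro hqB
          obtain ⟨hq1, hq2⟩ := mem_powersetCard.1 hq
          obtain ⟨k, hk⟩ := card_pos.1 (by omega : 0 < q.card)
          exact disjoint_left.1 hBU (hqB hk) (hq1 hk)
        simp [this]
      have z3 : ∑ a ∈ B, ∑ v ∈ U, (if insert b {a, v} ∈ H ∧ ¬ ({a, v} : Finset (Fin n)) ⊆ B then (1:ℝ) else 0) = K1 := by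
        refine sum_congr rfl fun a ha => sum_congr rfl fun v hv => ?_
        have : ¬ ({a, v} : Finset (Fin n)) ⊆ B := by
          intro hqB
          exact disjoint_left.1 hBU (hqB (by simp)) hv
        simp [this]
      rw [z1, z2, z3]; ring
    rw [← e1]
    have hbK : ∀ q ∈ K, b ∉ q := by
      intro q hq hbq
      rcases mem_union.1 ((mem_powersetCard.1 (mem_filter.1 hq).1).1 hbq) with h' | h'
      · exact hbB h'
      · exact hbU h'
    rw [← card_image_insert' b K hbK]
    exact_mod_cast card_le_card (by
      intro e he
      obtain ⟨q, hq, rfl⟩ := mem_image.1 he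
      obtain ⟨hq1, hq2, hq3⟩ := mem_filter.1 hq
      refine mem_filter.2 ⟨mem_sdiff.2 ⟨hq2, ?_⟩, mem_insert_self _ _⟩
      intro h'
      apply hq3
      intro k hk
      rcases mem_union.1 ((mem_powersetCard.1 hq1).1 hk) with h2 | h2
      · exact h2
      · exact absurd ((mem_powersetCard.1 h').1 (mem_insert_of_mem hk)) (mem_sdiff.1 h2).2)
  have hg1 : 1 ≤ g := by
    obtain ⟨v, hv⟩ := card_pos.1 hu
    have hvb : b ≠ v := by rintro rfl; exact hbU hv
    obtain ⟨k, hk, hkH⟩ := h.cover hV b v (hAs hb) (mem_sdiff.1 hv).1 hvb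
    refine card_pos.2 ⟨_, mem_filter.2 ⟨mem_sdiff.2 ⟨hkH, fun h' => ?_⟩, mem_insert_self _ _⟩⟩
    exact (mem_sdiff.1 hv).2 ((mem_powersetCard.1 h').1 (by simp))
  have har := heavy_arith t U.card ht hu g hg1 hc (K1 + K2) m Y hmp hKg (by linarith) hYm
  have hxb : 0 ≤ x b - m := by linarith [hmax t0 ht0]
  have h1 := mul_le_mul_of_nonneg_left hD2 hxb
  have h2 : (x b - m) * Y ≤ m * (U.card * Y + (K1 + K2 - U.card * (t - 2)) * m) := by
    push_cast at hsum
    nlinarith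
  have h3 : (2 * x b) * Y ≤ (m * (t + U.card - 1)) * Y := by
    have := mul_le_mul_of_nonneg_left har hmp.le
    nlinarith
  exact le_of_mul_le_mul_right h3 hYp

lemma Opt.u2 {t : ℕ} {A : Finset (Fin n)} {H} {x : Fin n → ℝ} (h : Opt t A H x) (hV : ∀ e ∈ H, e ⊆ supp x)
    (ht : 5 ≤ t) (hAs : A ⊆ supp x) (hu : 2 ≤ (supp x \ A).card) : False := by
  classical
  have hne : A.Nonempty := by rw [← card_pos, h.cardA]; omega
  obtain ⟨t0, ht0, hmin⟩ := exists_min_image A x hne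
  obtain ⟨b, hb, hmax⟩ := exists_max_image A x hne
  have hheavy := h.heavy hV ht hAs (by omega) t0 b ht0 hb hmin hmax
  set U := supp x \ A with hU
  have hUne : U.Nonempty := card_pos.1 (by omega)
  obtain ⟨w, hw, hwmin⟩ := exists_min_image U x hUne
  obtain ⟨v, hv, hvw⟩ := exists_mem_ne (by omega : 1 < U.card) w
  have hws := (mem_sdiff.1 hw).1
  have hwA := (mem_sdiff.1 hw).2
  have hvs := (mem_sdiff.1 hv).1
  have hvA := (mem_sdiff.1 hv).2
  have hUm : ∀ k ∈ U, x k ≤ x t0 := fun k hk => h.O3 t0 k ht0 (mem_sdiff.1 hk).2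
  have hbig : ∀ k ∈ supp x, x k ≤ x b := by
    intro k hk
    by_cases hkA : k ∈ A
    · exact hmax k hkA
    · exact h.O3 b k hb hkA
  have hcard : (supp x).card = t + U.card := by
    have := card_sdiff_add_card_eq_card hAs
    rw [← hU, h.cardA] at this; omega
  set Hw := H.filter fun e => w ∈ e with hHw
  set d := Hw.card with hd
  let dg : Fin n → ℕ := fun a => (Hw.filter fun e => a ∈ e).card
  have hVw : (supp x).erase w |>.Nonempty := ⟨v, mem_erase.2 ⟨hvw, hvs⟩⟩
  obtain ⟨a, ha, hamin⟩ := exists_min_image ((supp x).erase w) dg hVw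
  have haw : a ≠ w := ne_of_mem_erase ha
  have has : a ∈ supp x := mem_of_mem_erase ha
  have hdg : (t + U.card - 1) * dg a ≤ 2 * d := by
    have h1 := card_nsmul_le_sum ((supp x).erase w) dg (dg a) hamin
    rw [card_erase_of_mem hws, hcard, smul_eq_mul] at h1
    refine h1.trans ?_
    have e1 : ∑ a ∈ (supp x).erase w, dg a = ∑ e ∈ Hw, (((supp x).erase w).filter fun a => a ∈ e).card := by
      simp only [dg, card_filter]
      rw [sum_comm]
    rw [e1, mul_comm, ← smul_eq_mul]
    refine sum_le_card_nsmul _ _ _ fun e he => ?_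
    obtain ⟨he1, he2⟩ := mem_filter.1 he
    have : (((supp x).erase w).filter fun a => a ∈ e) ⊆ e.erase w := by
      intro k hk
      obtain ⟨hk1, hk2⟩ := mem_filter.1 hk
      exact mem_erase.2 ⟨ne_of_mem_erase hk1, hk2⟩
    have := card_le_card this
    rw [card_erase_of_mem he2, h.adm.1 e he1] at this
    exact this
  have hD2 : D2 (supp x \ {w, a}) H w a x ≤ dg a * x b := by
    rw [D2, ← sum_filter]
    set N := (supp x \ {w, a}).filter fun k => insert w (insert a {k}) ∈ H with hN
    have h1 : N.card ≤ dg a := by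
      refine card_le_card_of_injOn (fun k => insert w (insert a ({k} : Finset (Fin n)))) ?_ ?_
      · intro k hk
        have := (mem_filter.1 hk).2
        simp only [coe_filter, Set.mem_ofPred_eq, hHw, mem_filter]
        exact ⟨⟨this, by simp⟩, by simp⟩
      · intro k hk l hl hkl
        have hk1 := (mem_filter.1 hk).1
        have hkl' : insert w (insert a ({k} : Finset (Fin n))) = insert w (insert a {l}) := hkl
        have : k ∈ insert w (insert a ({l} : Finset (Fin n))) := by rw [← hkl']; simp
        simp only [mem_sdiff, mem_insert, mem_singleton, not_or] at this hk1
        tauto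
    have h2 := sum_le_card_nsmul N x (x b) fun k hk => hbig k (mem_sdiff.1 (mem_filter.1 hk).1).1
    rw [nsmul_eq_mul] at h2
    have h3 : (N.card : ℝ) ≤ dg a := by exact_mod_cast h1
    exact h2.trans (mul_le_mul_of_nonneg_right h3 (h.legal.2 b))
  -- the new triples
  set T := (powersetCard 2 A).image (insert v) with hT
  have hTv : ∀ q ∈ powersetCard 2 A, v ∉ q := fun q hq h' => hvA ((mem_powersetCard.1 hq).1 h')
  have hTc : T.card = Nat.choose t 2 := by
    rw [hT, card_image_insert' v _ hTv, card_powersetCard, h.cardA]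
  have hTw : ∀ e ∈ T, w ∉ e := by
    intro e he hwe
    obtain ⟨q, hq, rfl⟩ := mem_image.1 he
    rcases mem_insert.1 hwe with h' | h'
    · exact hvw h'.symm
    · exact hwA ((mem_powersetCard.1 hq).1 h')
  have hTd : d ≤ (T \ H).card := by
    have hsub : powersetCard 3 A ∪ ((T ∩ H) ∪ Hw) ⊆ H :=
      union_subset h.adm.2.1 (union_subset inter_subset_right (filter_subset _ _))
    have d1 : Disjoint (T ∩ H) Hw := by
      rw [disjoint_left]; intro e h1 h2
      exact hTw e (mem_inter.1 h1).1 (mem_filter.1 h2).2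
    have d2 : Disjoint (powersetCard 3 A) ((T ∩ H) ∪ Hw) := by
      rw [disjoint_left]; intro e h1 h2
      have h1' := (mem_powersetCard.1 h1).1
      rcases mem_union.1 h2 with h2 | h2
      · obtain ⟨q, hq, rfl⟩ := mem_image.1 (mem_inter.1 h2).1
        exact hvA (h1' (mem_insert_self _ _))
      · exact hwA (h1' (mem_filter.1 h2).2)
    have h1 := card_le_card hsub
    rw [card_union_of_disjoint d2, card_union_of_disjoint d1, card_powersetCard] at h1
    have h2 := h.adm.2.2
    have h3 : Nat.choose (t - 1) 2 ≤ Nat.choose t 2 := Nat.choose_le_choose _ (by omega)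
    have h4 := card_sdiff_add_card_inter T H
    omega
  obtain ⟨Q, hQT, hQc⟩ := exists_subset_card_eq hTd
  have hQH : ∀ q ∈ Q, q ∉ H := fun q hq => (mem_sdiff.1 (hQT hq)).2
  set y := sh x w a (x w) with hy
  have hyl : isLegal y := sh_legal x h.legal w a haw.symm (x w) (h.legal.2 w) le_rfl
  have hyw : y w = 0 := by rw [hy, sh_i _ _ _ haw.symm]; simp
  have hyk : ∀ k, k ≠ w → x k ≤ y k := by
    intro k hk
    by_cases hka : k = a
    · subst hka; rw [hy, sh_j]; linarith [h.legal.2 w]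
    · rw [hy, sh_k _ _ _ _ hk hka]
  have hadm : Adm t A ((H \ Hw) ∪ Q) := by
    refine ⟨fun e he => ?_, fun e he => ?_, ?_⟩
    · rcases mem_union.1 he with he | he
      · exact h.adm.1 e (mem_sdiff.1 he).1
      · obtain ⟨q, hq, rfl⟩ := mem_image.1 (mem_sdiff.1 (hQT he)).1
        rw [card_insert_of_notMem (hTv q hq), (mem_powersetCard.1 hq).2]
    · refine mem_union_left _ (mem_sdiff.2 ⟨h.adm.2.1 he, fun h' => ?_⟩)
      exact hwA ((mem_powersetCard.1 he).1 (mem_filter.1 h').2)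
    · exact (card_replace H Hw Q (filter_subset _ _) (by omega)).trans h.adm.2.2
  have hpwH : pw y H = pw x H - x w ^ 2 * D2 (supp x \ {w, a}) H w a x := by
    have e1 := pw_shift (supp x) H h.adm.1 hV w a hws has haw.symm x (x w)
    have e2 := h.stat hV w a hws has haw.symm
    rw [e2] at e1
    rw [hy, e1]; ring
  have hpwHw : pw y Hw = 0 := sum_eq_zero fun e he => prod_eq_zero (mem_filter.1 he).2 hyw
  have hm0 : 0 ≤ x t0 := h.legal.2 t0
  have hpwQ : (d : ℝ) * (x v * x t0 ^ 2) ≤ pw y Q := by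
    rw [← hQc, ← nsmul_eq_mul]
    refine card_nsmul_le_sum _ _ _ fun e he => ?_
    obtain ⟨q, hq, rfl⟩ := mem_image.1 (mem_sdiff.1 (hQT he)).1
    obtain ⟨hq1, hq2⟩ := mem_powersetCard.1 hq
    rw [prod_insert (hTv q hq)]
    obtain ⟨i, l, hil, rfl⟩ := card_eq_two.1 hq2
    rw [prod_pair hil, pow_two]
    have hA' : ∀ k ∈ A, x t0 ≤ y k := fun k hk =>
      (hmin k hk).trans (hyk k (by rintro rfl; exact hwA hk))
    have hi := hA' i (hq1 (by simp))
    have hl := hA' l (hq1 (by simp))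
    exact mul_le_mul (hyk v hvw) (mul_le_mul hi hl hm0 (hm0.trans hi)) (mul_nonneg hm0 hm0) (hyl.2 v)
  have hfin : x w ^ 2 * D2 (supp x \ {w, a}) H w a x ≤ d * (x v * x t0 ^ 2) := by
    have hdg' : ((t:ℝ) + U.card - 1) * dg a ≤ 2 * d := by
      have : ((t + U.card - 1 : ℕ) : ℝ) * dg a ≤ 2 * d := by exact_mod_cast hdg
      rw [Nat.cast_sub (by omega)] at this
      push_cast at this; exact this
    have h1 : D2 (supp x \ {w, a}) H w a x ≤ d * x t0 := by
      have e1 := mul_le_mul_of_nonneg_left hheavy (Nat.cast_nonneg (α := ℝ) (dg a))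
      have e2 := mul_le_mul_of_nonneg_right hdg' hm0
      nlinarith
    have h2 : x w ^ 2 ≤ x v * x t0 := by
      rw [pow_two]; exact mul_le_mul (hwmin v hv) (hUm w hw) (h.legal.2 w) (h.legal.2 v)
    have h3 : 0 ≤ (d:ℝ) * x t0 := mul_nonneg (Nat.cast_nonneg _) hm0
    calc x w ^ 2 * D2 (supp x \ {w, a}) H w a x ≤ x w ^ 2 * (d * x t0) := mul_le_mul_of_nonneg_left h1 (sq_nonneg _)
      _ ≤ (x v * x t0) * (d * x t0) := mul_le_mul_of_nonneg_right h2 h3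
      _ = _ := by ring
  have hval : pw x H ≤ pw y ((H \ Hw) ∪ Q) := by
    rw [pw_replace y H Hw Q (filter_subset _ _) hQH, hpwH, hpwHw]; linarith
  have := h.hsup A _ y h.cardA hadm hyl hval
  have h9 := supp_sh x w a haw.symm hws has
  rw [← hy] at h9
  omega

/-- the pure bound -/
lemma pure_bound {t : ℕ} (ht : 5 ≤ t) (A₀ : Finset (Fin n)) (H₀) (x₀ : Fin n → ℝ) (hA₀ : A₀.card = t) (hH₀ : Adm t A₀ H₀)
    (hx₀ : isLegal x₀) : 6 * pw x₀ H₀ ≤ ((t : ℝ) - 1) * ((t : ℝ) - 2) / (t : ℝ) ^ 2 := by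
  classical
  obtain ⟨A, H, x, h⟩ := exists_opt t A₀ H₀ x₀ hA₀ hH₀ hx₀
  have hle := h.hopt A₀ H₀ x₀ hA₀ hH₀ hx₀
  suffices hs : supp x ⊆ A by
    have h1 : pw x H ≤ ∑ q ∈ powersetCard 3 A, ∏ i ∈ q, x i := by
      rw [← pw_filter]
      refine pw_mono x h.legal.2 _ _ fun e he => ?_
      obtain ⟨he1, he2⟩ := mem_filter.1 he
      exact mem_powersetCard.2 ⟨he2.trans hs, h.adm.1 e he1⟩
    have h2 : ∑ i ∈ A, x i = 1 := by
      rw [← h.legal.1]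
      refine sum_subset (subset_univ _) fun k _ hk => ?_
      by_contra h0; exact hk (hs ((mem_supp x k).2 h0))
    have := six_sig_le A x t ht h.cardA h2 h.legal.2
    linarith
  by_contra hno
  have hAs : A ⊆ supp x := by
    intro a ha
    rw [mem_supp]
    intro h0
    apply hno
    intro k hk
    by_contra hkA
    have := h.O3 a k ha hkA
    have := h.pos k hk
    linarith
  have h' := h.trim hAs
  have hV : ∀ e ∈ H.filter (fun e => e ⊆ supp x), e ⊆ supp x := fun e he => (mem_filter.1 he).2
  obtain ⟨v, hv, hvA⟩ := not_subset.1 hno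
  by_cases hu : 2 ≤ (supp x \ A).card
  · exact h'.u2 hV ht hAs hu
  · have h1 : supp x \ A = {v} := by
      symm; apply eq_of_subset_of_card_le
      · simpa using ⟨hv, hvA⟩
      · simp; omega
    refine h'.u1 hV ht v hvA ?_
    rw [insert_eq, ← h1, sdiff_union_of_subset hAs]

lemma sum_sh (N : Finset (Fin n)) (x : Fin n → ℝ) (i j : Fin n) (hi : i ∈ N) (hj : j ∉ N) (ε : ℝ) :
    ∑ k ∈ N, sh x i j ε k = ∑ k ∈ N, x k - ε := by
  have hij : i ≠ j := by rintro rfl; exact hj hi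
  rw [← add_sum_erase _ _ hi, ← add_sum_erase _ x hi, sh_i _ _ _ hij]
  have : ∑ k ∈ N.erase i, sh x i j ε k = ∑ k ∈ N.erase i, x k := by
    refine sum_congr rfl fun k hk => sh_k _ _ _ _ (ne_of_mem_erase hk) ?_ _
    rintro rfl; exact hj (mem_of_mem_erase hk)
  rw [this]; ring

lemma pw_swap (σ : Equiv.Perm (Fin n)) (y : Fin n → ℝ) (G : Finset (Finset (Fin n))) :
    pw y (G.image fun e => e.image σ) = pw (y ∘ σ) G := by
  rw [pw, sum_image, pw]
  · refine sum_congr rfl fun e _ => ?_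
    rw [prod_image σ.injective.injOn]; rfl
  · intro p _ q _ hpq
    exact image_injective σ.injective hpq

lemma adm_swap {t : ℕ} {S : Finset (Fin n)} {G} (h : Adm t S G) (i j : Fin n) (hi : i ∈ S) (hj : j ∈ S) :
    Adm t S (G.image fun e => e.image (Equiv.swap i j)) := by
  have hS : ∀ k ∈ S, Equiv.swap i j k ∈ S := by
    intro k hk
    by_cases h1 : k = i
    · subst h1; rw [Equiv.swap_apply_left]; exact hj
    · by_cases h2 : k = j
      · subst h2; rw [Equiv.swap_apply_right]; exact hi
      · rw [Equiv.swap_apply_of_ne_of_ne h1 h2]; exact hk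
  refine ⟨fun e he => ?_, fun e he => ?_, card_image_le.trans h.2.2⟩
  · obtain ⟨q, hq, rfl⟩ := mem_image.1 he
    rw [card_image_of_injective _ (Equiv.swap i j).injective]; exact h.1 q hq
  · obtain ⟨he1, he2⟩ := mem_powersetCard.1 he
    refine mem_image.2 ⟨e.image (Equiv.swap i j), h.2.1 (mem_powersetCard.2 ⟨?_, ?_⟩), ?_⟩
    · intro k hk
      obtain ⟨l, hl, rfl⟩ := mem_image.1 hk
      exact hS l (he1 hl)
    · rw [card_image_of_injective _ (Equiv.swap i j).injective, he2]
    · ext k; simp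

lemma sh_swap (x : Fin n → ℝ) (i j : Fin n) (hij : i ≠ j) (ε : ℝ) :
    sh x i j (x i - x j + ε) ∘ Equiv.swap i j = sh x j i ε := by
  funext k
  simp only [Function.comp]
  by_cases h1 : k = i
  · subst h1; rw [Equiv.swap_apply_left, sh_j, sh_j]; ring
  · by_cases h2 : k = j
    · subst h2; rw [Equiv.swap_apply_right, sh_i _ _ _ hij, sh_i _ _ _ hij.symm]; ring
    · rw [Equiv.swap_apply_of_ne_of_ne h1 h2, sh_k _ _ _ _ h1 h2, sh_k _ _ _ _ h2 h1]

lemma mixed_zero {t : ℕ} (ht : 5 ≤ t) (A S N : Finset (Fin n)) (hAS : A ⊆ S) (hA : A.card = t) (hN : N = S \ A)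
    (G) (x : Fin n → ℝ) (hG : Adm t S G) (hx : isLegal x)
    (hopt : ∀ G' y, Adm t S G' → isLegal y → 6 * pw y G' - ∑ k ∈ N, y k ≤ 6 * pw x G - ∑ k ∈ N, x k)
    (i : Fin n) (hi : i ∈ N) : x i = 0 := by
  classical
  by_contra hi0
  have hip : 0 < x i := lt_of_le_of_ne (hx.2 i) (Ne.symm hi0)
  have hiS : i ∈ S := by rw [hN] at hi; exact (mem_sdiff.1 hi).1
  have hiA : i ∉ A := by rw [hN] at hi; exact (mem_sdiff.1 hi).2
  have main : ∀ j ∈ A, 1 / 5 ≤ x j := by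
    intro j hj
    have hjS := hAS hj
    have hjN : j ∉ N := by rw [hN]; simp [hj]
    have hij : i ≠ j := by rintro rfl; exact hiA hj
    have hsubU : ∀ e ∈ G, e ⊆ univ := fun e _ => subset_univ e
    set R := (univ : Finset (Fin n)) \ {i, j} with hR
    have s1 : 6 * (D1 R G j x - D1 R G i x + (x i - x j) * D2 R G i j x) + 1 ≤ 0 := by
      refine quad_aux _ (6 * D2 R G i j x) (x i) hip fun ε h0 h1 => ?_
      have := hopt G _ hG (sh_legal x hx i j hij ε h0 h1)
      rw [pw_shift univ G hG.1 hsubU i j (mem_univ _) (mem_univ _) hij, sum_sh N x i j hi hjN, ← hR] at this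
      linarith
    have hlt : x i < x j := by
      by_contra hge
      push Not at hge
      have s2 : ∀ ε, 0 ≤ ε → ε ≤ x j →
          (x i - x j) + ε * (6 * (D1 R G i x - D1 R G j x + (x j - x i) * D2 R G i j x) + 1) - ε ^ 2 * (6 * D2 R G i j x) ≤ 0 := by
        intro ε h0 h1
        have := hopt _ _ (adm_swap hG i j hiS hjS) (sh_legal x hx i j hij (x i - x j + ε) (by linarith) (by linarith))
        rw [pw_swap, sh_swap x i j hij, sum_sh N x i j hi hjN,
          pw_shift univ G hG.1 hsubU j i (mem_univ _) (mem_univ _) hij.symm, pair_comm j i, ← hR, D2_comm R G j i] at this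
        linarith
      by_cases hj0 : x j = 0
      · have := s2 0 le_rfl (hx.2 j)
        linarith
      · have hjp : 0 < x j := lt_of_le_of_ne (hx.2 j) (Ne.symm hj0)
        have := quad_aux _ (6 * D2 R G i j x) (x j) hjp fun ε h0 h1 => by
          have := s2 ε h0 h1
          have h3 : ε * (6 * (D1 R G i x - D1 R G j x + (x j - x i) * D2 R G i j x) + 1) - ε ^ 2 * (6 * D2 R G i j x) ≤ 0 := by
            linarith
          exact h3
        linarith
    have hD1 : D1 R G i x ≤ D1 R G j x := by
      rw [D1, D1]
      refine sum_le_sum fun q hq => ?_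
      obtain ⟨hq1, hq2⟩ := mem_powersetCard.1 hq
      have hiq : i ∉ q := fun h' => by have := hq1 h'; simp [hR] at this
      have hjq : j ∉ q := fun h' => by have := hq1 h'; simp [hR] at this
      have hprod : 0 ≤ ∏ k ∈ q, x k := prod_nonneg fun k _ => hx.2 k
      by_cases h1 : insert i q ∈ G
      · by_cases h2 : insert j q ∈ G
        · rw [if_pos h1, if_pos h2]
        · rw [if_pos h1, if_neg h2]
          have hadm : Adm t S ((G \ {insert i q}) ∪ {insert j q}) := by
            refine ⟨fun e he => ?_, fun e he => ?_, ?_⟩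
            · rcases mem_union.1 he with he | he
              · exact hG.1 e (mem_sdiff.1 he).1
              · rw [mem_singleton.1 he, card_insert_of_notMem hjq, hq2]
            · refine mem_union_left _ (mem_sdiff.2 ⟨hG.2.1 he, fun h' => ?_⟩)
              rw [mem_singleton] at h'
              subst h'
              apply h2; apply hG.2.1
              rw [mem_powersetCard, card_insert_of_notMem hjq, hq2]
              exact ⟨insert_subset hjS ((subset_insert _ _).trans (mem_powersetCard.1 he).1), rfl⟩
            · exact (card_replace G _ _ (by simpa using h1) (by simp)).trans hG.2.2
          have := hopt _ x hadm hx
          rw [pw_replace x G _ _ (by simpa using h1) (by simpa using h2)] at this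
          have e1 : pw x {insert i q} = x i * ∏ k ∈ q, x k := by rw [pw, sum_singleton, prod_insert hiq]
          have e2 : pw x {insert j q} = x j * ∏ k ∈ q, x k := by rw [pw, sum_singleton, prod_insert hjq]
          rw [e1, e2] at this
          by_contra hpos
          push Not at hpos
          nlinarith
      · rw [if_neg h1]; split_ifs
        · exact hprod
        · exact le_rfl
    have hD2 : D2 R G i j x ≤ 1 - x i - x j := by
      have h1 := D2_le R G i j x hx.2
      have h2 := sum_sdiff (f := x) (subset_univ ({i, j} : Finset (Fin n)))
      rw [sum_pair hij, hx.1, ← hR] at h2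
      linarith
    have h1 : (x j - x i) * D2 R G i j x ≤ (x j - x i) * (1 - x i - x j) :=
      mul_le_mul_of_nonneg_left hD2 (by linarith)
    have hxi1 : x i ≤ 1 := by rw [← hx.1]; exact single_le_sum (fun k _ => hx.2 k) (mem_univ i)
    by_contra hc
    push Not at hc
    nlinarith
  have h1 := card_nsmul_le_sum A x (1/5) main
  rw [hA, nsmul_eq_mul] at h1
  have h2 : ∑ k ∈ insert i A, x k ≤ 1 := by
    rw [← hx.1]; exact sum_le_sum_of_subset_of_nonneg (subset_univ _) fun k _ _ => hx.2 k
  rw [sum_insert hiA] at h2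
  have ht' : (5:ℝ) ≤ t := by exact_mod_cast ht
  linarith

lemma mixed {t : ℕ} (ht : 5 ≤ t) (A S : Finset (Fin n)) (hAS : A ⊆ S) (hA : A.card = t)
    (G₀) (x₀ : Fin n → ℝ) (hG₀ : Adm t S G₀) (hx₀ : isLegal x₀) :
    6 * pw x₀ G₀ - ∑ k ∈ S \ A, x₀ k ≤ ((t : ℝ) - 1) * ((t : ℝ) - 2) / (t : ℝ) ^ 2 := by
  classical
  set N := S \ A with hN
  have h1 : ∀ H : Finset (Finset (Fin n)), ∃ y : Fin n → ℝ, isLegal y ∧ ∀ z, isLegal z →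
      6 * pw z H - ∑ k ∈ N, z k ≤ 6 * pw y H - ∑ k ∈ N, y k := by
    intro H
    have hc : Continuous fun x : Fin n → ℝ => 6 * pw x H - ∑ k ∈ N, x k := by
      have := pw_cont H
      fun_prop
    obtain ⟨y, hy, hm⟩ := legal_compact.exists_isMaxOn (f := fun x : Fin n → ℝ => 6 * pw x H - ∑ k ∈ N, x k) ⟨x₀, hx₀⟩ hc.continuousOn
    exact ⟨y, hy, fun z hz => hm hz⟩
  choose Y hY1 hY2 using h1
  let T : Finset (Finset (Finset (Fin n))) := univ.filter fun p => Adm t S p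
  obtain ⟨G, hp, hpm⟩ := exists_max_image T (fun p => 6 * pw (Y p) p - ∑ k ∈ N, Y p k) ⟨G₀, by simp [T, hG₀]⟩
  set x := Y G with hxG
  have hx : isLegal x := hY1 G
  have hG : Adm t S G := by simpa [T] using hp
  have hopt : ∀ G' y, Adm t S G' → isLegal y → 6 * pw y G' - ∑ k ∈ N, y k ≤ 6 * pw x G - ∑ k ∈ N, x k :=
    fun G' y h2 h3 => (hY2 G' y h3).trans (hpm G' (by simp [T, h2]))
  have hz := mixed_zero ht A S N hAS hA hN G x hG hx hopt
  refine (hopt G₀ x₀ hG₀ hx₀).trans ?_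
  rw [sum_eq_zero hz, sub_zero]
  set H := powersetCard 3 A ∪ (G \ powersetCard 3 S) with hH
  have hle : pw x G ≤ pw x H := by
    rw [← pw_filter]
    refine pw_mono x hx.2 _ _ fun e he => ?_
    obtain ⟨he1, he2⟩ := mem_filter.1 he
    rw [hH, mem_union]
    by_cases heS : e ∈ powersetCard 3 S
    · left
      obtain ⟨e1, e2⟩ := mem_powersetCard.1 heS
      refine mem_powersetCard.2 ⟨fun k hk => ?_, e2⟩
      by_contra hkA
      exact (mem_supp x k).1 (he2 hk) (hz k (mem_sdiff.2 ⟨e1 hk, hkA⟩))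
    · right; exact mem_sdiff.2 ⟨he1, heS⟩
  have hadm : Adm t A H := by
    refine ⟨fun e he => ?_, subset_union_left, ?_⟩
    · rcases mem_union.1 he with he | he
      · exact (mem_powersetCard.1 he).2
      · exact hG.1 e (mem_sdiff.1 he).1
    · have h1 := card_union_le (powersetCard 3 A) (G \ powersetCard 3 S)
      have h2 := card_sdiff_add_card_eq_card hG.2.1
      have h3 := hG.2.2
      rw [card_powersetCard] at h1 h2
      rw [← hH] at h1
      omega
  have := pure_bound ht A H x hA hadm hx
  linarith

lemma lag_split (E : Finset (Finset (Fin n))) (hE : ∀ e ∈ E, e.card = 1 ∨ e.card = 3) (x : Fin n → ℝ) :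
    lagPoly E x = ∑ i ∈ univ.filter (fun i => {i} ∈ E), x i + 6 * pw x (E.filter fun e => e.card = 3) := by
  classical
  have h1 : ∑ i ∈ univ.filter (fun i => {i} ∈ E), x i = ∑ e ∈ E.filter (fun e => e.card = 1), ∏ i ∈ e, x i := by
    have : E.filter (fun e => e.card = 1) = (univ.filter (fun i => {i} ∈ E)).image fun i => ({i} : Finset (Fin n)) := by
      ext e
      simp only [mem_filter, mem_image, mem_univ, true_and]
      constructor
      · rintro ⟨h1, h2⟩
        obtain ⟨i, rfl⟩ := card_eq_one.1 h2
        exact ⟨i, h1, rfl⟩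
      · rintro ⟨i, h1, rfl⟩; exact ⟨h1, by simp⟩
    rw [this, sum_image]
    · simp
    · intro a _ b _ hab; exact singleton_injective hab
  rw [h1, pw, sum_filter, sum_filter, mul_sum, ← sum_add_distrib, lagPoly]
  refine sum_congr rfl fun e he => ?_
  rcases hE e he with h | h <;> simp [h, Nat.factorial]

lemma upper {t : ℕ} (ht : 5 ≤ t) (E : Finset (Finset (Fin n))) (hE : ∀ e ∈ E, e.card = 1 ∨ e.card = 3)
    (S : Finset (Fin n)) (hS : t ≤ S.card) (hSE : powersetCard 3 S ⊆ E)
    (hc : (E.filter fun e => e.card = 3).card ≤ Nat.choose S.card 3 + Nat.choose (t - 1) 2)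
    (hL : (S.filter fun i => {i} ∈ E).card ≤ t) (x : Fin n → ℝ) (hx : isLegal x) :
    lagPoly E x ≤ 1 + ((t : ℝ) - 1) * ((t : ℝ) - 2) / (t : ℝ) ^ 2 := by
  classical
  obtain ⟨A, hA1, hA2, hA3⟩ := exists_subsuperset_card_eq (filter_subset (fun i => {i} ∈ E) S) hL hS
  have hadm : Adm t S (E.filter fun e => e.card = 3) :=
    ⟨fun e he => (mem_filter.1 he).2, fun e he => mem_filter.2 ⟨hSE he, (mem_powersetCard.1 he).2⟩, hc⟩
  have h1 := mixed ht A S hA2 hA3 _ x hadm hx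
  rw [lag_split E hE]
  have h2 : ∑ i ∈ univ.filter (fun i => {i} ∈ E), x i + ∑ i ∈ S \ A, x i ≤ 1 := by
    rw [← sum_union, ← hx.1]
    · exact sum_le_sum_of_subset_of_nonneg (subset_univ _) fun k _ _ => hx.2 k
    · rw [disjoint_left]; intro k h1 h2
      obtain ⟨h3, h4⟩ := mem_sdiff.1 h2
      exact h4 (hA1 (mem_filter.2 ⟨h3, (mem_filter.1 h1).2⟩))
  linarith

lemma lower {t : ℕ} (ht : 5 ≤ t) (E : Finset (Finset (Fin n))) (hE : ∀ e ∈ E, e.card = 1 ∨ e.card = 3)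
    (C : Finset (Fin n)) (hC : C.card = t) (hCE : isCompleteSub E ({1, 3} : Finset ℕ) C) :
    ∃ x : Fin n → ℝ, isLegal x ∧ 1 + ((t : ℝ) - 1) * ((t : ℝ) - 2) / (t : ℝ) ^ 2 ≤ lagPoly E x := by
  classical
  have ht' : (5:ℝ) ≤ t := by exact_mod_cast ht
  let y : Fin n → ℝ := fun i => if i ∈ C then 1 / t else 0
  have hy0 : ∀ i, 0 ≤ y i := fun i => by simp only [y]; split_ifs <;> positivity
  have hyC : ∀ i ∈ C, y i = 1 / t := fun i hi => by simp only [y]; rw [if_pos hi]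
  have s1 : ∑ i ∈ C, y i = 1 := by
    rw [sum_congr rfl hyC, sum_const, hC, nsmul_eq_mul]; field_simp
  have s2 : ∑ i ∈ C, y i ^ 2 = 1 / t := by
    rw [sum_congr rfl fun i hi => by rw [hyC i hi], sum_const, hC, nsmul_eq_mul]; field_simp
  have s3 : ∑ i ∈ C, y i ^ 3 = 1 / t ^ 2 := by
    rw [sum_congr rfl fun i hi => by rw [hyC i hi], sum_const, hC, nsmul_eq_mul]; field_simp
  have hyl : isLegal y := by
    refine ⟨?_, hy0⟩
    rw [← s1]; symm
    exact sum_subset (subset_univ _) fun k _ hk => by simp only [y]; rw [if_neg hk]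
  refine ⟨y, hyl, ?_⟩
  rw [lag_split E hE]
  have h1 : (1:ℝ) ≤ ∑ i ∈ univ.filter (fun i => {i} ∈ E), y i := by
    rw [← s1]
    refine sum_le_sum_of_subset_of_nonneg (fun i hi => ?_) fun k _ _ => hy0 k
    exact mem_filter.2 ⟨mem_univ _, hCE {i} (by simpa using hi) (by simp)⟩
  have h2 := pw_mono y hy0 (powersetCard 3 C) (E.filter fun e => e.card = 3) (fun e he => by
    obtain ⟨e1, e2⟩ := mem_powersetCard.1 he
    exact mem_filter.2 ⟨hCE e e1 (by simp [e2]), e2⟩)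
  have h3 := six_sig C y
  rw [s1, s2, s3] at h3
  have h4 : ((t : ℝ) - 1) * ((t : ℝ) - 2) / (t : ℝ) ^ 2 = 1 ^ 3 - 3 * 1 * (1 / t) + 2 * (1 / (t:ℝ) ^ 2) := by
    field_simp; ring
  rw [h4, ← h3]
  rw [pw] at h2
  linarith

lemma lag_eq {t : ℕ} (ht : 5 ≤ t) (E : Finset (Finset (Fin n))) (hE : ∀ e ∈ E, e.card = 1 ∨ e.card = 3)
    (S : Finset (Fin n)) (hS : t ≤ S.card) (hSE : powersetCard 3 S ⊆ E)
    (hc : (E.filter fun e => e.card = 3).card ≤ Nat.choose S.card 3 + Nat.choose (t - 1) 2)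
    (hL : (S.filter fun i => {i} ∈ E).card ≤ t)
    (C : Finset (Fin n)) (hC : C.card = t) (hCE : isCompleteSub E ({1, 3} : Finset ℕ) C) :
    lagrangian E = 1 + ((t : ℝ) - 1) * ((t : ℝ) - 2) / (t : ℝ) ^ 2 := by
  obtain ⟨x, hx, hxl⟩ := lower ht E hE C hC hCE
  have hu := upper ht E hE S hS hSE hc hL
  rw [lagrangian]
  apply IsGreatest.csSup_eq
  refine ⟨⟨x, hx, le_antisymm (hu x hx) hxl⟩, ?_⟩
  rintro _ ⟨y, hy, rfl⟩
  exact hu y hy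

end Lag

/-- Motzkin–Straus type theorem for {1,3}-graphs (Theorem 7 of the paper). -/
theorem lagrangian_one_three_graph (t s n : ℕ) (ht : 5 ≤ t) (hst : t ≤ s)
    (E : Finset (Finset (Fin n)))
    (hR : E.image Finset.card = ({1, 3} : Finset ℕ))
    (hmax13 : maxCompleteOrder E ({1, 3} : Finset ℕ) t)
    (hmax3 : maxCompleteOrder (E.filter fun e => e.card = 3) ({3} : Finset ℕ) s)
    (hlow : Nat.choose s 3 ≤ (E.filter fun e => e.card = 3).card)
    (hhigh : (E.filter fun e => e.card = 3).card ≤ Nat.choose s 3 + Nat.choose (t - 1) 2) :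
    lagrangian E = lagrangian (completeEdges t ({1, 3} : Finset ℕ)) ∧
    lagrangian (completeEdges t ({1, 3} : Finset ℕ)) =
      1 + ((t : ℝ) - 1) * ((t : ℝ) - 2) / (t : ℝ) ^ 2 := by
  have hE : ∀ e ∈ E, e.card = 1 ∨ e.card = 3 := by
    intro e he
    have : e.card ∈ E.image Finset.card := Finset.mem_image_of_mem _ he
    rw [hR] at this
    simpa using this
  obtain ⟨⟨S, hSc, hS⟩, -⟩ := hmax3
  obtain ⟨⟨C, hCc, hC⟩, h13⟩ := hmax13
  have hSE : Finset.powersetCard 3 S ⊆ E := by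
    intro e he
    obtain ⟨e1, e2⟩ := Finset.mem_powersetCard.1 he
    exact (Finset.mem_filter.1 (hS e e1 (by simp [e2]))).1
  have hL : (S.filter fun i => {i} ∈ E).card ≤ t := by
    apply h13
    intro e he hc
    simp only [Finset.mem_insert, Finset.mem_singleton] at hc
    rcases hc with hc | hc
    · obtain ⟨i, rfl⟩ := Finset.card_eq_one.1 hc
      exact (Finset.mem_filter.1 (he (Finset.mem_singleton_self i))).2
    · exact hSE (Finset.mem_powersetCard.2 ⟨he.trans (Finset.filter_subset _ _), hc⟩)
  have h1 := Lag.lag_eq ht E hE S (by omega) hSE (by rw [hSc]; exact hhigh) hL C hCc hC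
  have hK : ∀ e : Finset (Fin t), e ∈ completeEdges t ({1, 3} : Finset ℕ) ↔ e.card = 1 ∨ e.card = 3 := by
    intro e; simp [completeEdges]
  have hcu : (Finset.univ : Finset (Fin t)).card = t := by simp
  have h2 := Lag.lag_eq ht (completeEdges t ({1, 3} : Finset ℕ)) (fun e he => (hK e).1 he) Finset.univ (by simp)
    (fun e he => (hK e).2 (Or.inr (Finset.mem_powersetCard.1 he).2))
    (by
      rw [← Finset.card_powersetCard]
      refine (Finset.card_le_card ?_).trans (Nat.le_add_right _ _)
      intro e he
      exact Finset.mem_powersetCard.2 ⟨Finset.subset_univ _, (Finset.mem_filter.1 he).2⟩)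
    ((Finset.card_filter_le _ _).trans (by simp)) Finset.univ hcu
    (fun e _ hc => (hK e).2 (by simpa using hc))
  exact ⟨h1.trans h2.symm, h2⟩
end

section
/- Let m and t ≥ 3 be positive integers satisfying C(t,3) ≤ m ≤ C(t,3) + C(t-1,2). Let G be a 3-uniform hypergraph with m edges that contains a clique of order t (a t-element vertex subset all of whose 3-element subsets are edges). Then λ(G) = λ([t]^{(3)}) = (t-1)(t-2)/(6t²). -/
open Finset

/-- λ(G,x) = Σ_{e∈E} ∏_{i∈e} x_i for a uniform hypergraph. -/
noncomputable def lagPolyU {n : ℕ} (E : Finset (Finset (Fin n))) (x : Fin n → ℝ) : ℝ :=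
  ∑ e ∈ E, ∏ i ∈ e, x i

/-- The Lagrangian λ(G): the maximum of λ(G,x) over legal weightings. -/
noncomputable def lagrangianU {n : ℕ} (E : Finset (Finset (Fin n))) : ℝ :=
  sSup {v : ℝ | ∃ x : Fin n → ℝ, isLegal x ∧ lagPolyU E x = v}

namespace LagT

/-- weight polynomial over ℕ-indexed vertices -/
noncomputable def W (E : Finset (Finset ℕ)) (x : ℕ → ℝ) : ℝ := ∑ e ∈ E, ∏ i ∈ e, x i

/-- the admissible families -/
def Good (t K n : ℕ) (E : Finset (Finset ℕ)) : Prop :=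
  E ⊆ powersetCard 3 (range n) ∧ E.card ≤ K ∧
    ∃ S ⊆ range n, S.card = t ∧ powersetCard 3 S ⊆ E

/-- legal weightings -/
def Leg (n : ℕ) (x : ℕ → ℝ) : Prop :=
  (∀ i, 0 ≤ x i) ∧ (∀ i, n ≤ i → x i = 0) ∧ ∑ i ∈ range n, x i = 1

lemma Leg.le_one {n : ℕ} {x : ℕ → ℝ} (h : Leg n x) (i : ℕ) : x i ≤ 1 := by
  by_cases hi : i < n
  · rw [← h.2.2]
    exact Finset.single_le_sum (fun j _ => h.1 j) (mem_range.2 hi)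
  · rw [h.2.1 i (by omega)]; norm_num

lemma continuous_W (E : Finset (Finset ℕ)) : Continuous (W E) := by
  unfold W; fun_prop

lemma isCompact_Leg (n : ℕ) : IsCompact {x | Leg n x} := by
  have h1 : IsCompact (Set.univ.pi (fun _ : ℕ => Set.Icc (0:ℝ) 1)) :=
    isCompact_univ_pi (fun _ => isCompact_Icc)
  refine h1.of_isClosed_subset ?_ ?_
  · unfold Leg
    simp only [Set.ofPred_and, Set.ofPred_forall]
    refine IsClosed.inter ?_ (IsClosed.inter ?_ ?_)
    · exact isClosed_iInter fun i => isClosed_le continuous_const (continuous_apply i)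
    · exact isClosed_iInter fun i => isClosed_iInter fun _ =>
        isClosed_eq (continuous_apply i) continuous_const
    · exact isClosed_eq (by fun_prop) continuous_const
  · intro x hx i _
    exact ⟨hx.1 i, Leg.le_one hx i⟩

lemma exists_max (t K n : ℕ) (hne : ∃ E, Good t K n E) (hx : ∃ x, Leg n x) :
    ∃ E x, Good t K n E ∧ Leg n x ∧ ∀ E' x', Good t K n E' → Leg n x' → W E' x' ≤ W E x := by
  classical
  have h1 : ∀ E, ∃ x, Leg n x ∧ ∀ x', Leg n x' → W E x' ≤ W E x := by
    intro E
    obtain ⟨x, hx1, hx2⟩ := (isCompact_Leg n).exists_isMaxOn hx (continuous_W E).continuousOn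
    exact ⟨x, hx1, fun x' hx' => hx2 hx'⟩
  choose X hX1 hX2 using h1
  let F := ((powersetCard 3 (range n)).powerset).filter (fun E => Good t K n E)
  have hF : ∀ E, E ∈ F ↔ Good t K n E := by
    intro E
    simp only [F, mem_filter, mem_powerset]
    exact ⟨fun h => h.2, fun h => ⟨h.1, h⟩⟩
  obtain ⟨E0, hE0⟩ := hne
  obtain ⟨E, hE, hmax⟩ := F.exists_max_image (fun E => W E (X E)) ⟨E0, (hF _).2 hE0⟩
  refine ⟨E, X E, (hF _).1 hE, hX1 E, fun E' x' hE' hx' => ?_⟩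
  exact (hX2 E' x' hx').trans (hmax E' ((hF _).2 hE'))

lemma exists_sort (n : ℕ) (x : ℕ → ℝ) :
    ∃ σ : Equiv.Perm ℕ, (∀ i, i < n ↔ σ i < n) ∧ ∀ i j, i ≤ j → j < n → x (σ j) ≤ x (σ i) := by
  let f : Fin n → ℝ := fun i => - x i
  let τ := Tuple.sort f
  have hm : Monotone (f ∘ τ) := Tuple.monotone_sort f
  let σ : Equiv.Perm ℕ := τ.extendDomain Fin.equivSubtype
  have hσ : ∀ i (h : i < n), σ i = τ ⟨i, h⟩ := by
    intro i h
    have := Equiv.Perm.extendDomain_apply_subtype τ (Fin.equivSubtype (n := n)) (b := i) h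
    simpa [σ] using this
  have hσ' : ∀ i, ¬ i < n → σ i = i := by
    intro i h
    exact Equiv.Perm.extendDomain_apply_not_subtype τ (Fin.equivSubtype (n := n)) h
  refine ⟨σ, ?_, ?_⟩
  · intro i
    by_cases h : i < n
    · simp [h, hσ i h]
    · simp [h, hσ' i h]
  · intro i j hij hj
    rw [hσ j hj, hσ i (by omega)]
    have := hm (show (⟨i, by omega⟩ : Fin n) ≤ ⟨j, hj⟩ from hij)
    simp only [f, Function.comp] at this
    linarith

lemma W_perm (E : Finset (Finset ℕ)) (x : ℕ → ℝ) (σ : Equiv.Perm ℕ) :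
    W (E.image (fun e => e.image σ.symm)) (x ∘ σ) = W E x := by
  unfold W
  rw [sum_image]
  · refine sum_congr rfl fun e _ => ?_
    rw [prod_image (fun a _ b _ h => σ.symm.injective h)]
    simp
  · intro a _ b _ h
    exact Finset.image_injective σ.symm.injective h

lemma Good_perm {t K n : ℕ} {E : Finset (Finset ℕ)} (h : Good t K n E) (σ : Equiv.Perm ℕ)
    (hσ : ∀ i, i < n ↔ σ i < n) : Good t K n (E.image (fun e => e.image σ.symm)) := by
  have hs : ∀ i, i < n → σ.symm i < n := by
    intro i hi
    rw [hσ]; simpa using hi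
  obtain ⟨h1, h2, S, hS, hSc, hSE⟩ := h
  refine ⟨?_, card_image_le.trans h2, S.image σ.symm, ?_, ?_, ?_⟩
  · intro e he
    obtain ⟨f, hf, rfl⟩ := mem_image.1 he
    have hf' := mem_powersetCard.1 (h1 hf)
    rw [mem_powersetCard, card_image_of_injective _ σ.symm.injective]
    refine ⟨?_, hf'.2⟩
    intro i hi
    obtain ⟨j, hj, rfl⟩ := mem_image.1 hi
    exact mem_range.2 (hs j (mem_range.1 (hf'.1 hj)))
  · intro i hi
    obtain ⟨j, hj, rfl⟩ := mem_image.1 hi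
    exact mem_range.2 (hs j (mem_range.1 (hS hj)))
  · rw [card_image_of_injective _ σ.symm.injective, hSc]
  · intro e he
    rw [mem_powersetCard] at he
    refine mem_image.2 ⟨e.image σ, hSE ?_, ?_⟩
    · rw [mem_powersetCard, card_image_of_injective _ σ.injective]
      refine ⟨?_, he.2⟩
      intro i hi
      obtain ⟨j, hj, rfl⟩ := mem_image.1 hi
      obtain ⟨l, hl, rfl⟩ := mem_image.1 (he.1 hj)
      simpa using hl
    · ext a; simp

lemma Leg_perm {n : ℕ} {x : ℕ → ℝ} (h : Leg n x) (σ : Equiv.Perm ℕ)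
    (hσ : ∀ i, i < n ↔ σ i < n) : Leg n (x ∘ σ) := by
  refine ⟨fun i => h.1 _, fun i hi => h.2.1 _ ?_, ?_⟩
  · by_contra hc
    have := (hσ i).2 (by omega)
    omega
  · rw [← h.2.2]
    refine sum_nbij' (fun i => σ i) (fun i => σ.symm i) ?_ ?_ ?_ ?_ ?_
    · intro i hi; simpa [← hσ i] using hi
    · intro i hi; simpa [hσ (σ.symm i)] using hi
    · simp
    · simp
    · simp

/-- the compression map -/
def cmap (E : Finset (Finset ℕ)) (i j : ℕ) (e : Finset ℕ) : Finset ℕ :=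
  if j ∈ e ∧ i ∉ e ∧ insert i (e.erase j) ∉ E then insert i (e.erase j) else e

lemma erase_insert_back {i j : ℕ} {e : Finset ℕ} (hj : j ∈ e) (hi : i ∉ e) :
    insert j ((insert i (e.erase j)).erase i) = e := by
  have : i ∉ e.erase j := fun h => hi (mem_of_mem_erase h)
  rw [erase_insert this, insert_erase hj]

lemma cmap_injOn (E : Finset (Finset ℕ)) (i j : ℕ) : Set.InjOn (cmap E i j) E := by
  intro a ha b hb hab
  have ha' : a ∈ E := ha
  have hb' : b ∈ E := hb
  unfold cmap at hab
  split_ifs at hab with h1 h2 h2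
  · rw [← erase_insert_back h1.1 h1.2.1, ← erase_insert_back h2.1 h2.2.1, hab]
  · exact absurd (hab ▸ hb') h1.2.2
  · exact absurd (hab ▸ ha') h2.2.2
  · exact hab

lemma cmap_good {t K n : ℕ} {E : Finset (Finset ℕ)} (h : Good t K n E) {i j : ℕ}
    (hij : i < j) (hj : j < n) : Good t K n (E.image (cmap E i j)) := by
  obtain ⟨h1, h2, S, hS, hSc, hSE⟩ := h
  have key : ∀ f ∈ E, (j ∈ f → i ∉ f → insert i (f.erase j) ∈ E) → f ∈ E.image (cmap E i j) := by
    intro f hf hh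
    refine mem_image.2 ⟨f, hf, ?_⟩
    unfold cmap
    rw [if_neg]
    rintro ⟨a, b, c⟩
    exact c (hh a b)
  refine ⟨?_, card_image_le.trans h2, ?_⟩
  · intro e he
    obtain ⟨f, hf, rfl⟩ := mem_image.1 he
    have hf' := mem_powersetCard.1 (h1 hf)
    unfold cmap
    split_ifs with hc
    · rw [mem_powersetCard]
      have hi : i ∉ f.erase j := fun h => hc.2.1 (mem_of_mem_erase h)
      refine ⟨?_, ?_⟩
      · intro a ha
        rcases mem_insert.1 ha with rfl | ha
        · exact mem_range.2 (by omega)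
        · exact hf'.1 (mem_of_mem_erase ha)
      · have := card_erase_add_one hc.1
        rw [card_insert_of_notMem hi]; omega
    · exact h1 hf
  · by_cases hjS : j ∈ S ∧ i ∉ S
    · obtain ⟨hjS, hiS⟩ := hjS
      have hi' : i ∉ S.erase j := fun h => hiS (mem_of_mem_erase h)
      refine ⟨insert i (S.erase j), ?_, ?_, ?_⟩
      · intro a ha
        rcases mem_insert.1 ha with rfl | ha
        · exact mem_range.2 (by omega)
        · exact hS (mem_of_mem_erase ha)
      · have := card_erase_add_one hjS
        rw [card_insert_of_notMem hi']; omega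
      · intro f hf
        rw [mem_powersetCard] at hf
        have hjf : j ∉ f := by
          intro h
          have := hf.1 h
          simp at this; omega
        by_cases hif : i ∈ f
        · by_cases hfE : f ∈ E
          · exact key f hfE (fun h => absurd h hjf)
          · have hjf' : j ∉ f.erase i := fun h => hjf (mem_of_mem_erase h)
            have hb : insert i ((insert j (f.erase i)).erase j) = f := erase_insert_back hif hjf
            have hg : insert j (f.erase i) ∈ E := by
              apply hSE
              rw [mem_powersetCard]
              constructor
              · intro a ha
                rcases mem_insert.1 ha with rfl | ha
                · exact hjS
                · have h1 := hf.1 (mem_of_mem_erase ha)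
                  have h2 := ne_of_mem_erase ha
                  simp [h2] at h1
                  exact h1.2
              · have := card_erase_add_one hif
                rw [card_insert_of_notMem hjf']; omega
            refine mem_image.2 ⟨_, hg, ?_⟩
            unfold cmap
            rw [if_pos, hb]
            refine ⟨mem_insert_self _ _, ?_, ?_⟩
            · simp; omega
            · rw [hb]; exact hfE
        · refine key f (hSE ?_) (fun h => absurd h hjf)
          rw [mem_powersetCard]
          refine ⟨fun a ha => ?_, hf.2⟩
          have h1 := hf.1 ha
          have h2 : a ≠ i := fun h => hif (h ▸ ha)
          simp [h2] at h1
          exact h1.2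
    · refine ⟨S, hS, hSc, fun f hf => key f (hSE hf) (fun hjf hif => hSE ?_)⟩
      rw [mem_powersetCard] at hf ⊢
      have hi' : i ∉ f.erase j := fun h => hif (mem_of_mem_erase h)
      have hjS' : j ∈ S := hf.1 hjf
      have hiS : i ∈ S := by
        by_contra h; exact hjS ⟨hjS', h⟩
      constructor
      · intro a ha
        rcases mem_insert.1 ha with rfl | ha
        · exact hiS
        · exact hf.1 (mem_of_mem_erase ha)
      · have := card_erase_add_one hjf
        rw [card_insert_of_notMem hi']; omega

lemma cmap_W {E : Finset (Finset ℕ)} {x : ℕ → ℝ} (hx : ∀ i, 0 ≤ x i) {i j : ℕ}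
    (hij : x j ≤ x i) : W E x ≤ W (E.image (cmap E i j)) x := by
  unfold W
  rw [sum_image (cmap_injOn E i j)]
  refine sum_le_sum fun e _ => ?_
  unfold cmap
  split_ifs with hc
  · have hi : i ∉ e.erase j := fun h => hc.2.1 (mem_of_mem_erase h)
    rw [prod_insert hi, ← mul_prod_erase e x hc.1]
    exact mul_le_mul_of_nonneg_right hij (prod_nonneg fun _ _ => hx _)
  · exact le_rfl

lemma cmap_sum {E : Finset (Finset ℕ)} {i j : ℕ} (hij : i < j)
    {e : Finset ℕ} (he : e ∈ E) (hje : j ∈ e) (hie : i ∉ e) (hn : insert i (e.erase j) ∉ E) :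
    ∑ f ∈ E.image (cmap E i j), ∑ a ∈ f, a < ∑ f ∈ E, ∑ a ∈ f, a := by
  rw [sum_image (cmap_injOn E i j)]
  have h : ∀ f : Finset ℕ, j ∈ f → i ∉ f → ∑ a ∈ insert i (f.erase j), a < ∑ a ∈ f, a := by
    intro f hj hi
    have hi' : i ∉ f.erase j := fun h => hi (mem_of_mem_erase h)
    rw [sum_insert hi', ← add_sum_erase f (fun a => a) hj]
    omega
  refine sum_lt_sum (fun f _ => ?_) ⟨e, he, ?_⟩
  · unfold cmap
    split_ifs with hc
    · exact (h f hc.1 hc.2.1).le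
    · exact le_rfl
  · unfold cmap
    rw [if_pos ⟨hje, hie, hn⟩]
    exact h e hje hie

/-- compressed families -/
def Comp (E : Finset (Finset ℕ)) : Prop :=
  ∀ e ∈ E, ∀ i j, i < j → j ∈ e → i ∉ e → insert i (e.erase j) ∈ E

lemma clique_range {t K n : ℕ} {E : Finset (Finset ℕ)} (h : Good t K n E) (hc : Comp E) :
    powersetCard 3 (range t) ⊆ E := by
  classical
  obtain ⟨h1, h2, S0, hS0, hSc0, hSE0⟩ := h
  let F := (range n).powerset.filter (fun S => S.card = t ∧ powersetCard 3 S ⊆ E)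
  obtain ⟨S, hSF, hmin⟩ := F.exists_min_image (fun S => ∑ a ∈ S, a)
    ⟨S0, by simp only [F, mem_filter, mem_powerset]; exact ⟨hS0, hSc0, hSE0⟩⟩
  simp only [F, mem_filter, mem_powerset] at hSF hmin
  obtain ⟨hS, hSc, hSE⟩ := hSF
  have hsub : range t ⊆ S := by
    intro i hi
    by_contra hiS
    have : ∃ j ∈ S, i < j := by
      by_contra hcon
      push Not at hcon
      have hss : S ⊆ range i := fun j hj => by
        have h1 := hcon j hj
        have : j ≠ i := fun h => hiS (h ▸ hj)
        exact mem_range.2 (by omega)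
      have := card_le_card hss
      simp at this hi
      omega
    obtain ⟨j, hj, hij⟩ := this
    have hi' : i ∉ S.erase j := fun h => hiS (mem_of_mem_erase h)
    have hnew := hmin (insert i (S.erase j)) ⟨?_, ?_, ?_⟩
    · rw [sum_insert hi', ← add_sum_erase S (fun a => a) hj] at hnew
      omega
    · intro a ha
      rcases mem_insert.1 ha with rfl | ha
      · have := mem_range.1 (hS hj)
        exact mem_range.2 (by omega)
      · exact hS (mem_of_mem_erase ha)
    · have := card_erase_add_one hj
      rw [card_insert_of_notMem hi']; omega
    · intro f hf
      rw [mem_powersetCard] at hf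
      have hjf : j ∉ f := by
        intro h
        have := hf.1 h
        simp at this; omega
      by_cases hif : i ∈ f
      · have hb : insert i ((insert j (f.erase i)).erase j) = f := erase_insert_back hif hjf
        have hjf' : j ∉ f.erase i := fun h => hjf (mem_of_mem_erase h)
        rw [← hb]
        refine hc _ (hSE ?_) i j hij (mem_insert_self _ _) ?_
        · rw [mem_powersetCard]
          constructor
          · intro a ha
            rcases mem_insert.1 ha with rfl | ha
            · exact hj
            · have h1 := hf.1 (mem_of_mem_erase ha)
              have h2 := ne_of_mem_erase ha
              simp [h2] at h1
              exact h1.2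
          · have := card_erase_add_one hif
            rw [card_insert_of_notMem hjf']; omega
        · simp; omega
      · refine hSE ?_
        rw [mem_powersetCard]
        refine ⟨fun a ha => ?_, hf.2⟩
        have h1 := hf.1 ha
        have h2 : a ≠ i := fun h => hif (h ▸ ha)
        simp [h2] at h1
        exact h1.2
  exact (powersetCard_mono hsub).trans hSE

lemma exists_nice (t K n : ℕ) (hne : ∃ E, Good t K n E) (hx : ∃ x, Leg n x) :
    ∃ E x, Good t K n E ∧ Leg n x ∧ (∀ E' x', Good t K n E' → Leg n x' → W E' x' ≤ W E x) ∧
      (∀ i j, i ≤ j → j < n → x j ≤ x i) ∧ Comp E ∧ powersetCard 3 (range t) ⊆ E := by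
  classical
  obtain ⟨E0, x0, hE0, hx0, hmax0⟩ := exists_max t K n hne hx
  obtain ⟨σ, hσ, hsort⟩ := exists_sort n x0
  set x := x0 ∘ σ with hxdef
  have hxL : Leg n x := Leg_perm hx0 σ hσ
  let F := ((powersetCard 3 (range n)).powerset).filter
    (fun E => Good t K n E ∧ W E x = W E0 x0)
  have hF : ∀ E, E ∈ F ↔ Good t K n E ∧ W E x = W E0 x0 := by
    intro E
    simp only [F, mem_filter, mem_powerset]
    exact ⟨fun h => h.2, fun h => ⟨h.1.1, h⟩⟩
  obtain ⟨E, hE, hmin⟩ := F.exists_min_image (fun E => ∑ f ∈ E, ∑ a ∈ f, a)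
    ⟨E0.image (fun e => e.image σ.symm), (hF _).2 ⟨Good_perm hE0 σ hσ, W_perm E0 x0 σ⟩⟩
  rw [hF] at hE
  have hanti : ∀ i j, i ≤ j → j < n → x j ≤ x i := hsort
  have hcomp : Comp E := by
    intro e he i j hij hje hie
    by_contra hn
    have hjn : j < n := mem_range.1 ((mem_powersetCard.1 (hE.1.1 he)).1 hje)
    have hg := cmap_good hE.1 hij hjn
    have hw := cmap_W (E := E) hxL.1 (hanti i j hij.le hjn)
    have hw2 := hmax0 _ _ hg hxL
    have := hmin _ ((hF _).2 ⟨hg, le_antisymm hw2 (hE.2 ▸ hw)⟩)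
    have := cmap_sum hij he hje hie hn
    omega
  refine ⟨E, x, hE.1, hxL, ?_, hanti, hcomp, clique_range hE.1 hcomp⟩
  rw [hE.2]; exact hmax0


noncomputable def Lk (E : Finset (Finset ℕ)) (T : Finset ℕ) (i : ℕ) (y : ℕ → ℝ) : ℝ :=
  ∑ f ∈ (powersetCard 2 T).filter (fun f => insert i f ∈ E), ∏ a ∈ f, y a

noncomputable def Rk (E : Finset (Finset ℕ)) (T : Finset ℕ) (i j : ℕ) (y : ℕ → ℝ) : ℝ :=
  ∑ l ∈ T.filter (fun l => insert i (insert j {l}) ∈ E), y l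

lemma Lk_eq {k : ℕ} {E : Finset (Finset ℕ)} (hE : E ⊆ powersetCard 3 (range k)) {i j : ℕ}
    (hij : i ≠ j) {T : Finset ℕ} (hT : ∀ a, a ∈ T ↔ a < k ∧ a ≠ i ∧ a ≠ j) (y : ℕ → ℝ) :
    ∑ e ∈ E.filter (fun e => i ∈ e ∧ j ∉ e), ∏ a ∈ e, y a = y i * Lk E T i y := by
  unfold Lk
  rw [mul_sum]
  symm
  have hiT : ∀ f, f ⊆ T → i ∉ f := fun f hf h => ((hT i).1 (hf h)).2.1 rfl
  have hjT : ∀ f, f ⊆ T → j ∉ f := fun f hf h => ((hT j).1 (hf h)).2.2 rfl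
  refine sum_nbij' (fun f => insert i f) (fun e => e.erase i) ?_ ?_ ?_ ?_ ?_
  · intro f hf
    rw [mem_filter, mem_powersetCard] at hf
    rw [mem_filter]
    refine ⟨hf.2, mem_insert_self _ _, ?_⟩
    rw [mem_insert]
    rintro (h | h)
    · exact hij h.symm
    · exact hjT f hf.1.1 h
  · intro e he
    rw [mem_filter] at he
    have := mem_powersetCard.1 (hE he.1)
    rw [mem_filter, mem_powersetCard, insert_erase he.2.1]
    refine ⟨⟨?_, ?_⟩, he.1⟩
    · intro a ha
      rw [mem_erase] at ha
      rw [hT]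
      refine ⟨mem_range.1 (this.1 ha.2), ha.1, ?_⟩
      rintro rfl
      exact he.2.2 ha.2
    · have h2 := card_erase_add_one he.2.1
      omega
  · intro f hf
    rw [mem_filter, mem_powersetCard] at hf
    exact erase_insert (hiT f hf.1.1)
  · intro e he
    rw [mem_filter] at he
    exact insert_erase he.2.1
  · intro f hf
    rw [mem_filter, mem_powersetCard] at hf
    rw [prod_insert (hiT f hf.1.1)]

lemma Rk_eq {k : ℕ} {E : Finset (Finset ℕ)} (hE : E ⊆ powersetCard 3 (range k)) {i j : ℕ}
    (hij : i ≠ j) {T : Finset ℕ} (hT : ∀ a, a ∈ T ↔ a < k ∧ a ≠ i ∧ a ≠ j) (y : ℕ → ℝ) :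
    ∑ e ∈ E.filter (fun e => i ∈ e ∧ j ∈ e), ∏ a ∈ e, y a = y i * y j * Rk E T i j y := by
  unfold Rk
  rw [mul_sum]
  symm
  refine sum_bij (fun l _ => insert i (insert j {l})) ?_ ?_ ?_ ?_
  · intro l hl
    rw [mem_filter] at hl
    rw [mem_filter]
    exact ⟨hl.2, by simp, by simp⟩
  · intro a ha b hb hab
    rw [mem_filter, hT] at ha hb
    have h1 : a ∈ insert i (insert j ({b} : Finset ℕ)) := by rw [← hab]; simp
    simp at h1
    tauto
  · intro e he
    rw [mem_filter] at he
    have := mem_powersetCard.1 (hE he.1)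
    have h1 := card_erase_add_one he.2.1
    have hj : j ∈ e.erase i := mem_erase.2 ⟨hij.symm, he.2.2⟩
    have h2 := card_erase_add_one hj
    have h3 : ((e.erase i).erase j).card = 1 := by omega
    obtain ⟨l, hl⟩ := card_eq_one.1 h3
    have hle : l ∈ (e.erase i).erase j := by rw [hl]; simp
    have heq : insert i (insert j ({l} : Finset ℕ)) = e := by
      rw [← hl, insert_erase hj, insert_erase he.2.1]
    rw [mem_erase, mem_erase] at hle
    refine ⟨l, ?_, heq⟩
    rw [mem_filter, hT, heq]
    exact ⟨⟨mem_range.1 (this.1 hle.2.2), hle.2.1, hle.1⟩, he.1⟩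
  · intro l hl
    rw [mem_filter, hT] at hl
    rw [prod_insert, prod_insert, prod_singleton]
    · ring
    · simp; tauto
    · simp; tauto

lemma W_two {k : ℕ} {E : Finset (Finset ℕ)} (hE : E ⊆ powersetCard 3 (range k)) {i j : ℕ}
    (hij : i ≠ j) {T : Finset ℕ} (hT : ∀ a, a ∈ T ↔ a < k ∧ a ≠ i ∧ a ≠ j) (y : ℕ → ℝ) :
    W E y = W (E.filter (fun e => i ∉ e ∧ j ∉ e)) y + y i * Lk E T i y + y j * Lk E T j y
      + y i * y j * Rk E T i j y := by
  rw [← Lk_eq hE hij hT, ← Lk_eq hE hij.symm (fun a => by rw [hT]; tauto), ← Rk_eq hE hij hT]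
  unfold W
  rw [← sum_filter_add_sum_filter_not E (fun e => i ∈ e),
    ← sum_filter_add_sum_filter_not (E.filter (fun e => i ∈ e)) (fun e => j ∈ e),
    ← sum_filter_add_sum_filter_not (E.filter (fun e => ¬ i ∈ e)) (fun e => j ∈ e)]
  simp only [filter_filter]
  have : (E.filter fun e => i ∉ e ∧ j ∈ e) = E.filter (fun e => j ∈ e ∧ i ∉ e) :=
    filter_congr (fun e _ => by tauto)
  rw [this]
  ring

lemma Lk_congr {E : Finset (Finset ℕ)} {T : Finset ℕ} {i : ℕ} {y z : ℕ → ℝ}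
    (h : ∀ a ∈ T, y a = z a) : Lk E T i y = Lk E T i z := by
  unfold Lk
  refine sum_congr rfl fun f hf => prod_congr rfl fun a ha => h a ?_
  rw [mem_filter, mem_powersetCard] at hf
  exact hf.1.1 ha

lemma Rk_congr {E : Finset (Finset ℕ)} {T : Finset ℕ} {i j : ℕ} {y z : ℕ → ℝ}
    (h : ∀ a ∈ T, y a = z a) : Rk E T i j y = Rk E T i j z := by
  unfold Rk
  refine sum_congr rfl fun f hf => h f ?_
  exact (mem_filter.1 hf).1

/-- move weight `s` from `j` to `i` -/
noncomputable def shift (x : ℕ → ℝ) (i j : ℕ) (s : ℝ) : ℕ → ℝ :=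
  fun a => if a = i then x i + s else if a = j then x j - s else x a

lemma W_shift {k : ℕ} {E : Finset (Finset ℕ)} (hE : E ⊆ powersetCard 3 (range k)) {i j : ℕ}
    (hij : i ≠ j) {T : Finset ℕ} (hT : ∀ a, a ∈ T ↔ a < k ∧ a ≠ i ∧ a ≠ j) (x : ℕ → ℝ) (s : ℝ) :
    W E (shift x i j s) = W E x + s * (Lk E T i x - Lk E T j x + (x j - x i) * Rk E T i j x)
      - s ^ 2 * Rk E T i j x := by
  have hs : ∀ a ∈ T, shift x i j s a = x a := by
    intro a ha
    rw [hT] at ha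
    simp [shift, ha.2.1, ha.2.2]
  rw [W_two hE hij hT (shift x i j s), W_two hE hij hT x, Lk_congr hs, Lk_congr hs, Rk_congr hs]
  have h0 : W (E.filter (fun e => i ∉ e ∧ j ∉ e)) (shift x i j s)
      = W (E.filter (fun e => i ∉ e ∧ j ∉ e)) x := by
    unfold W
    refine sum_congr rfl fun e he => prod_congr rfl fun a ha => ?_
    rw [mem_filter] at he
    have h1 : a ≠ i := fun h => he.2.1 (h ▸ ha)
    have h2 : a ≠ j := fun h => he.2.2 (h ▸ ha)
    simp [shift, h1, h2]
  have hi : shift x i j s i = x i + s := by simp [shift]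
  have hj : shift x i j s j = x j - s := by simp [shift, hij.symm]
  rw [h0, hi, hj]
  ring

lemma Leg_shift {k : ℕ} {x : ℕ → ℝ} (hx : Leg k x) {i j : ℕ} (hij : i ≠ j) (hi : i < k)
    (hj : j < k) {s : ℝ} (h1 : 0 ≤ x i + s) (h2 : 0 ≤ x j - s) : Leg k (shift x i j s) := by
  refine ⟨?_, ?_, ?_⟩
  · intro a
    unfold shift
    split_ifs
    · exact h1
    · exact h2
    · exact hx.1 a
  · intro a ha
    have h1 : a ≠ i := by omega
    have h2 : a ≠ j := by omega
    simp [shift, h1, h2, hx.2.1 a ha]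
  · rw [← hx.2.2]
    have hi' : i ∈ range k := mem_range.2 hi
    have hj' : j ∈ (range k).erase i := mem_erase.2 ⟨hij.symm, mem_range.2 hj⟩
    rw [← add_sum_erase _ _ hi', ← add_sum_erase _ _ hj', ← add_sum_erase _ x hi',
      ← add_sum_erase _ x hj']
    have : ∑ a ∈ ((range k).erase i).erase j, shift x i j s a
        = ∑ a ∈ ((range k).erase i).erase j, x a := by
      refine sum_congr rfl fun a ha => ?_
      rw [mem_erase, mem_erase] at ha
      simp [shift, ha.1, ha.2.1]
    have hi : shift x i j s i = x i + s := by simp [shift]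
    have hj : shift x i j s j = x j - s := by simp [shift, hij.symm]
    rw [this, hi, hj]; ring

lemma quad_zero {D R a b : ℝ} (ha : 0 < a) (hb : 0 < b)
    (h : ∀ s, -a ≤ s → s ≤ b → s * D - s ^ 2 * R ≤ 0) (hR : 0 ≤ R) : D = 0 := by
  have key : ∀ D : ℝ, ∀ c > 0, (∀ s, 0 ≤ s → s ≤ c → s * D - s ^ 2 * R ≤ 0) → D ≤ 0 := by
    intro D c hc h
    by_contra hD
    push Not at hD
    let s := min c (D / (2 * (R + 1)))
    have hs0 : 0 < s := lt_min hc (by positivity)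
    have hs1 : s ≤ c := min_le_left _ _
    have hs2 : s ≤ D / (2 * (R + 1)) := min_le_right _ _
    rw [le_div_iff₀ (by positivity)] at hs2
    have := h s hs0.le hs1
    have h3 : s * (D - s * R) ≤ 0 := by linarith [this, sq s, (by ring : s * (D - s * R) = s * D - s ^ 2 * R)]
    have h4 : 0 < D - s * R := by nlinarith [mul_nonneg hs0.le hR]
    exact absurd h3 (not_le.2 (mul_pos hs0 h4))
  apply le_antisymm
  · exact key D b hb (fun s h1 h2 => h s (by linarith) h2)
  · have := key (-D) a ha (fun s h1 h2 => by
      have := h (-s) (by linarith) (by linarith)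
      linarith [this, (by ring : (-s) * D - (-s) ^ 2 * R = s * (-D) - s ^ 2 * R)])
    linarith

lemma foc {k : ℕ} {E : Finset (Finset ℕ)} (hE : E ⊆ powersetCard 3 (range k)) {x : ℕ → ℝ}
    (hx : Leg k x) (hmax : ∀ y, Leg k y → W E y ≤ W E x) {i j : ℕ}
    (hij : i ≠ j) (hi : i < k) (hj : j < k) (hxi : 0 < x i) (hxj : 0 < x j)
    {T : Finset ℕ} (hT : ∀ a, a ∈ T ↔ a < k ∧ a ≠ i ∧ a ≠ j) :
    Lk E T i x - Lk E T j x + (x j - x i) * Rk E T i j x = 0 := by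
  refine quad_zero hxi hxj ?_ (sum_nonneg fun a _ => hx.1 a) (R := Rk E T i j x)
  intro s h1 h2
  have := hmax _ (Leg_shift hx hij hi hj (s := s) (by linarith) (by linarith))
  rw [W_shift hE hij hT] at this
  linarith


lemma exists_avg_subset {α : Type*} [DecidableEq α] (f : α → ℝ) (d : ℕ) :
    ∀ s : Finset α, d ≤ s.card →
      ∃ D ⊆ s, D.card = d ∧ (d : ℝ) * ∑ a ∈ s, f a ≤ s.card * ∑ a ∈ D, f a := by
  intro s
  induction hn : s.card - d generalizing s with
  | zero =>
    intro h
    have : s.card = d := by omega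
    exact ⟨s, Subset.refl _, this, by rw [this]⟩
  | succ r ih =>
    intro h
    have hs : s.Nonempty := card_pos.1 (by omega)
    obtain ⟨a, ha, hmin⟩ := s.exists_min_image f hs
    have hc := card_erase_add_one ha
    obtain ⟨D, hD, hDc, hle⟩ := ih (s.erase a) (by omega) (by omega)
    refine ⟨D, hD.trans (erase_subset _ _), hDc, ?_⟩
    have h1 : (d : ℝ) * f a ≤ ∑ b ∈ D, f b := by
      have := card_nsmul_le_sum D f (f a) (fun b hb => hmin b (mem_of_mem_erase (hD hb)))
      rw [hDc, nsmul_eq_mul] at this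
      exact this
    have h2 : (s.card : ℝ) = ((s.erase a).card : ℝ) + 1 := by exact_mod_cast hc.symm
    rw [← add_sum_erase s f ha, h2]
    linarith

lemma comp_tri {E : Finset (Finset ℕ)} (hc : Comp E) {a b c i : ℕ}
    (h : insert a (insert b ({c} : Finset ℕ)) ∈ E) (hic : i < c) (hac : a ≠ c) (hbc : b ≠ c)
    (hia : i ≠ a) (hib : i ≠ b) : insert a (insert b ({i} : Finset ℕ)) ∈ E := by
  have := hc _ h i c hic (by simp) (by simp; omega)
  convert this using 1
  ext z
  simp only [mem_insert, mem_singleton, mem_erase]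
  omega

lemma tri_rot (a b c : ℕ) : insert a (insert b ({c} : Finset ℕ)) = insert c (insert a {b}) := by
  ext z; simp only [mem_insert, mem_singleton]; omega

lemma tri_swap (a b c : ℕ) : insert a (insert b ({c} : Finset ℕ)) = insert b (insert a {c}) := by
  ext z; simp only [mem_insert, mem_singleton]; omega

lemma tri_swap2 (a b c : ℕ) : insert a (insert b ({c} : Finset ℕ)) = insert a (insert c {b}) := by
  ext z; simp only [mem_insert, mem_singleton]; omega

/-- the vertices joined with the pair `m, m+1` -/
def LL (E : Finset (Finset ℕ)) (m : ℕ) : Finset ℕ :=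
  (range m).filter (fun l => insert m (insert (m+1) {l}) ∈ E)

/-- pairs missing from the link of `v` -/
def MM (E : Finset (Finset ℕ)) (m v : ℕ) : Finset (Finset ℕ) :=
  (powersetCard 2 (range m)).filter (fun f => insert v f ∉ E)

lemma LL_full {E : Finset (Finset ℕ)} (hc : Comp E) {m l j : ℕ} (hl : l ∈ LL E m)
    (hj : j ≤ m) (hjl : j ≠ l) : insert (m+1) (insert l {j}) ∈ E := by
  obtain ⟨h1, h2⟩ := mem_filter.1 hl
  rw [mem_range] at h1
  rw [tri_rot, tri_rot] at h2
  rcases Nat.lt_or_ge j m with h | h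
  · exact comp_tri hc (c := m) h2 h (by omega) (by omega) (by omega) (by omega)
  · have : j = m := by omega
    rw [this]; exact h2

lemma zero_mem_LL {E : Finset (Finset ℕ)} (hc : Comp E) {m l : ℕ} (hl : l ∈ LL E m) :
    0 ∈ LL E m := by
  obtain ⟨h1, h2⟩ := mem_filter.1 hl
  rw [mem_range] at h1
  refine mem_filter.2 ⟨mem_range.2 (by omega), ?_⟩
  rcases Nat.eq_zero_or_pos l with h | h
  · rw [← h]; exact h2
  · exact comp_tri hc h2 h (by omega) (by omega) (by omega) (by omega)

lemma ratio {m : ℕ} {E : Finset (Finset ℕ)} (hE : E ⊆ powersetCard 3 (range (m+2)))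
    {x : ℕ → ℝ} (hx : Leg (m+2) x) (hmax : ∀ y, Leg (m+2) y → W E y ≤ W E x)
    (hanti : ∀ i j, i ≤ j → j < m+2 → x j ≤ x i) (hc : Comp E) (hpos : 0 < x (m+1))
    (hm : 0 < m) (hL : (LL E m).Nonempty) :
    (m : ℝ) * x (m+1) * (x 0 - x m - x (m+1)) ≤ ∑ f ∈ MM E m m, ∏ a ∈ f, x a := by
  obtain ⟨l0, hl0⟩ := hL
  have h0 := zero_mem_LL hc hl0
  set T1 := (range m).erase 0 with hT1
  have hq : m + 1 ∉ T1 := by simp [hT1]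
  have hT : ∀ a, a ∈ insert (m+1) T1 ↔ a < m+2 ∧ a ≠ 0 ∧ a ≠ m := by
    intro a; simp [hT1]; omega
  have hp : ∀ i, i < m+2 → 0 < x i := fun i hi => hpos.trans_le (hanti i (m+1) (by omega) (by omega))
  have hfoc := foc hE hx hmax (i := 0) (j := m) (by omega) (by omega) (by omega)
    (hp 0 (by omega)) (hp m (by omega)) hT
  have hR : Rk E (insert (m+1) T1) 0 m x = ∑ l ∈ insert (m+1) T1, x l := by
    unfold Rk
    rw [filter_true_of_mem]
    intro l hl
    rw [hT] at hl
    have h1 := (mem_filter.1 h0).2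
    rw [tri_rot] at h1
    rcases Nat.lt_or_ge l (m+1) with h | h
    · exact comp_tri hc h1 h (by omega) (by omega) (by omega) (by omega)
    · have : l = m+1 := by omega
      rw [this]; exact h1
  set Z := ∑ l ∈ insert (m+1) T1, x l with hZ
  have hnn : ∀ f : Finset ℕ, 0 ≤ ∏ a ∈ f, x a := fun f => prod_nonneg fun a _ => hx.1 a
  have hb : Lk E (insert (m+1) T1) 0 x - Lk E (insert (m+1) T1) m x ≤
      ∑ f ∈ (powersetCard 2 (insert (m+1) T1)).filter (fun f => insert m f ∉ E), ∏ a ∈ f, x a := by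
    unfold Lk
    have h1 := sum_filter_add_sum_filter_not (powersetCard 2 (insert (m+1) T1))
      (fun f => insert m f ∈ E) (fun f => ∏ a ∈ f, x a)
    have h2 : ∑ f ∈ (powersetCard 2 (insert (m+1) T1)).filter (fun f => insert 0 f ∈ E),
        ∏ a ∈ f, x a ≤ ∑ f ∈ powersetCard 2 (insert (m+1) T1), ∏ a ∈ f, x a :=
      sum_le_sum_of_subset_of_nonneg (filter_subset _ _) (fun f _ _ => hnn f)
    linarith
  have hcc : ∑ f ∈ (powersetCard 2 (insert (m+1) T1)).filter (fun f => insert m f ∉ E),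
      ∏ a ∈ f, x a ≤ ∑ f ∈ MM E m m, ∏ a ∈ f, x a + x (m+1) * Z := by
    have hsub : (powersetCard 2 (insert (m+1) T1)).filter (fun f => insert m f ∉ E) ⊆
        MM E m m ∪ T1.image (fun l => insert (m+1) {l}) := by
      intro f hf
      obtain ⟨hf1, hf2⟩ := mem_filter.1 hf
      rw [powersetCard_succ_insert hq, mem_union] at hf1
      rw [mem_union]
      rcases hf1 with h | h
      · left
        exact mem_filter.2 ⟨powersetCard_mono (erase_subset _ _) h, hf2⟩
      · right
        obtain ⟨g, hg, rfl⟩ := mem_image.1 h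
        rw [powersetCard_one, mem_map] at hg
        obtain ⟨l, hl, rfl⟩ := hg
        exact mem_image.2 ⟨l, hl, rfl⟩
    refine (sum_le_sum_of_subset_of_nonneg hsub (fun f _ _ => hnn f)).trans ?_
    have h3 : ∑ f ∈ MM E m m ∪ T1.image (fun l => insert (m+1) {l}), ∏ a ∈ f, x a ≤
        ∑ f ∈ MM E m m, ∏ a ∈ f, x a + ∑ f ∈ T1.image (fun l => insert (m+1) {l}), ∏ a ∈ f, x a := by
      rw [← sum_union_inter]
      linarith [sum_nonneg (s := MM E m m ∩ T1.image (fun l => insert (m+1) {l}))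
        (f := fun f => ∏ a ∈ f, x a) (fun f _ => hnn f)]
    refine h3.trans ?_
    have h4 : ∑ f ∈ T1.image (fun l => insert (m+1) ({l} : Finset ℕ)), ∏ a ∈ f, x a
        = x (m+1) * ∑ l ∈ T1, x l := by
      rw [sum_image, mul_sum]
      · refine sum_congr rfl fun l hl => ?_
        rw [prod_insert, prod_singleton]
        simp only [mem_singleton]; rintro rfl; exact hq hl
      · intro a ha b hb hab
        have h1 : a ∈ insert (m+1) ({b} : Finset ℕ) := by
          have : a ∈ insert (m+1) ({a} : Finset ℕ) := by simp
          simp only at hab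
          rwa [hab] at this
        simp only [mem_insert, mem_singleton] at h1
        rcases h1 with h | h
        · subst h; exact absurd ha hq
        · exact h
    have h5 : ∑ l ∈ T1, x l ≤ Z := by
      rw [hZ, sum_insert hq]; linarith
    rw [h4]
    have := mul_le_mul_of_nonneg_left h5 hpos.le
    linarith
  rw [hR] at hfoc
  have hfin : (x 0 - x m - x (m+1)) * Z ≤ ∑ f ∈ MM E m m, ∏ a ∈ f, x a := by
    linarith [(by ring : (x 0 - x m - x (m+1)) * Z = -((x m - x 0) * Z) - x (m+1) * Z)]
  have hZlow : (m : ℝ) * x (m+1) ≤ Z := by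
    have h6 : (insert (m+1) T1).card = m := by
      rw [card_insert_of_notMem hq, hT1, card_erase_of_mem (mem_range.2 hm), card_range]; omega
    have := card_nsmul_le_sum (insert (m+1) T1) x (x (m+1)) (fun i hi => by
      rw [hT] at hi
      exact hanti i (m+1) (by omega) (by omega))
    rw [h6, nsmul_eq_mul] at this
    exact this
  rcases le_or_gt 0 (x 0 - x m - x (m+1)) with h | h
  · exact (by nlinarith : (m : ℝ) * x (m+1) * (x 0 - x m - x (m+1)) ≤ (x 0 - x m - x (m+1)) * Z).trans hfin
  · have h7 : 0 ≤ ∑ f ∈ MM E m m, ∏ a ∈ f, x a := sum_nonneg fun f _ => hnn f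
    have h8 : (0:ℝ) ≤ (m : ℝ) * x (m+1) := by positivity
    nlinarith

/-- number of edges at the last vertex -/
lemma deg_bound {m : ℕ} {E : Finset (Finset ℕ)} (hE : E ⊆ powersetCard 3 (range (m+2)))
    (hc : Comp E) :
    (LL E m).card * (m + 1) ≤ 2 * (E.filter (fun e => m+1 ∈ e)).card := by
  set Q := E.filter (fun e => m+1 ∈ e) with hQ
  have h1 : (LL E m).card * m ≤ ∑ e ∈ Q, (LL E m ∩ e).card := by
    apply le_sum_card_inter
    intro l hl
    have hlm : l < m := mem_range.1 (mem_filter.1 hl).1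
    have : ((range (m+1)).erase l).card = m := by
      rw [card_erase_of_mem (mem_range.2 (by omega)), card_range]; omega
    rw [← this]
    refine card_le_card_of_injOn (fun j => insert (m+1) (insert l {j})) ?_ ?_
    · intro j hj
      have hj' := mem_erase.1 (mem_coe.1 hj)
      rw [mem_range] at hj'
      refine mem_coe.2 (mem_filter.2 ⟨mem_filter.2 ⟨LL_full hc hl (by omega) hj'.1, by simp⟩, by simp⟩)
    · intro a ha b hb hab
      have ha' := mem_erase.1 (mem_coe.1 ha)
      rw [mem_range] at ha'
      have h1 : a ∈ insert (m+1) (insert l ({b} : Finset ℕ)) := by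
        have : a ∈ insert (m+1) (insert l ({a} : Finset ℕ)) := by simp
        simp only at hab
        rwa [hab] at this
      simp only [mem_insert, mem_singleton] at h1
      omega
  have h2 : ({m} : Finset ℕ).card * (LL E m).card ≤ ∑ e ∈ Q, (({m} : Finset ℕ) ∩ e).card := by
    apply le_sum_card_inter
    intro l hl
    rw [mem_singleton] at hl
    subst hl
    refine card_le_card_of_injOn (fun j => insert l (insert (l+1) {j})) ?_ ?_
    · intro j hj
      have hj' := mem_filter.1 (mem_coe.1 hj)
      exact mem_coe.2 (mem_filter.2 ⟨mem_filter.2 ⟨hj'.2, by simp⟩, by simp⟩)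
    · intro a ha b hb hab
      have ha' := mem_filter.1 (mem_coe.1 ha)
      rw [mem_range] at ha'
      have h1 : a ∈ insert l (insert (l+1) ({b} : Finset ℕ)) := by
        have : a ∈ insert l (insert (l+1) ({a} : Finset ℕ)) := by simp
        simp only at hab
        rwa [hab] at this
      simp only [mem_insert, mem_singleton] at h1
      omega
  have h3 : ∑ e ∈ Q, ((LL E m ∩ e).card + (({m} : Finset ℕ) ∩ e).card) ≤ ∑ e ∈ Q, 2 := by
    refine sum_le_sum fun e he => ?_
    obtain ⟨he1, he2⟩ := mem_filter.1 he
    have hcard := (mem_powersetCard.1 (hE he1)).2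
    have hdis : Disjoint (LL E m ∩ e) (({m} : Finset ℕ) ∩ e) := by
      rw [disjoint_left]
      intro a ha hb
      have h1 := mem_range.1 (mem_filter.1 (mem_inter.1 ha).1).1
      have h2 := mem_singleton.1 (mem_inter.1 hb).1
      omega
    rw [← card_union_of_disjoint hdis]
    have hsub : (LL E m ∩ e) ∪ (({m} : Finset ℕ) ∩ e) ⊆ e.erase (m+1) := by
      intro a ha
      rw [mem_erase]
      rcases mem_union.1 ha with h | h
      · have h1 := mem_range.1 (mem_filter.1 (mem_inter.1 h).1).1
        exact ⟨by omega, (mem_inter.1 h).2⟩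
      · have h2 := mem_singleton.1 (mem_inter.1 h).1
        exact ⟨by omega, (mem_inter.1 h).2⟩
    have h4 := card_le_card hsub
    have h5 := card_erase_add_one he2
    omega
  rw [sum_add_distrib, sum_const, smul_eq_mul] at h3
  rw [card_singleton] at h2
  nlinarith


lemma case_eq {b M d : ℝ} {xp xq x0 B : ℝ} (hb : 1 ≤ b) (hq : 0 < xq) (hpq : xq ≤ xp)
    (hd : b ≤ d) (hM : d * xp ^ 2 ≤ M) (h1 : (xp - xq) * B = M) (hB : B ≤ b * x0)
    (hr : x0 - xp - xq ≤ 0) : False := by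
  have h2 : (xp - xq) * B ≤ (xp - xq) * (b * (xp + xq)) := by
    apply mul_le_mul_of_nonneg_left _ (by linarith)
    exact hB.trans (mul_le_mul_of_nonneg_left (by linarith) (by linarith))
  have h3 : b * xp ^ 2 ≤ d * xp ^ 2 := mul_le_mul_of_nonneg_right hd (by positivity)
  have h4 : 0 < b * xq ^ 2 := by positivity
  nlinarith

/-- loss estimate -/
lemma loss_bound {b m w : ℝ} {xp xq x0 B : ℝ} (hb : 0 ≤ b) (hm : 0 < m) (hq : 0 < xq)
    (hB : B ≤ b * x0) (hr : m * xq * (x0 - xp - xq) ≤ w) :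
    m * (xq ^ 2 * B) ≤ m * (b * xq ^ 2 * (xp + xq)) + b * xq * w := by
  have h1 : m * (xq ^ 2 * B) ≤ m * (xq ^ 2 * (b * x0)) := by gcongr
  have h2 : b * xq * (m * xq * (x0 - xp - xq)) ≤ b * xq * w := by gcongr
  nlinarith

lemma case1 {b m w d μ G : ℝ} {xp xq x0 B : ℝ} (hb : 0 ≤ b) (hm : 3 ≤ m) (hq : 0 < xq)
    (hpq : xq ≤ xp) (hbm : b ≤ m)
    (hB : B ≤ b * x0) (hr : m * xq * (x0 - xp - xq) ≤ w) (hw : μ * xp ^ 2 ≤ w) (hw0 : 0 ≤ w)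
    (hd : b * (m + 1) ≤ 2 * d) (hG : (xp + xq) * w + (d - μ) * xp ^ 3 ≤ G)
    (hlt : G < xq ^ 2 * B) : False := by
  have h := loss_bound hb (by linarith) hq hB hr
  have hp : 0 < xp := by linarith
  have h1 : b * xq * w ≤ m * xq * w := by gcongr
  have h2 : b * xq ^ 2 * (xp + xq) ≤ b * xp ^ 2 * (xp + xp) := by gcongr
  have h3 : 2 * b ≤ d := by nlinarith
  have h4 : 2 * b * xp ^ 3 ≤ d * xp ^ 3 := by gcongr
  have h5 : xp * (μ * xp ^ 2) ≤ xp * w := by gcongr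
  have h6 : xq ^ 2 * B ≤ b * xq ^ 2 * (xp + xq) + xq * w := by
    have hm0 : 0 < m := by linarith
    have : m * (xq ^ 2 * B) ≤ m * (b * xq ^ 2 * (xp + xq) + xq * w) := by linarith
    exact le_of_mul_le_mul_left this hm0
  nlinarith

lemma case2 {b m w d μ wD G : ℝ} {xp xq x0 B : ℝ} (hb : 0 ≤ b) (hm : 3 ≤ m) (hq : 0 < xq)
    (hpq : xq ≤ xp) 
    (hB : B ≤ b * x0) (hr : m * xq * (x0 - xp - xq) ≤ w) (hw0 : 0 ≤ w) (hμ0 : 0 < μ)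
    (hμ : 2 * μ ≤ m * (m + 1)) (hwD : d * xp ^ 2 ≤ wD) (hav : d * w ≤ μ * wD)
    (hd : b * (m + 1) ≤ 2 * d) (hG : (xp + xq) * wD ≤ G)
    (hlt : G < xq ^ 2 * B) : False := by
  have h := loss_bound hb (by linarith) hq hB hr
  have hp : 0 < xp := by linarith
  have hm0 : 0 < m := by linarith
  have h2 : b * xq ^ 2 * (xp + xq) ≤ b * xp ^ 2 * (xp + xp) := by gcongr
  have h3 : 2 * b ≤ d := by nlinarith
  have h4 : 2 * b * xp ^ 3 ≤ d * xp ^ 3 := by gcongr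
  have h5 : xp * (d * xp ^ 2) ≤ xp * wD := by gcongr
  have h7 : b * w ≤ m * wD := by
    have e1 : b * μ ≤ m * d := by nlinarith
    have e2 : (b * μ) * w ≤ (m * d) * w := by gcongr
    have e3 : m * (d * w) ≤ m * (μ * wD) := by gcongr
    have : μ * (b * w) ≤ μ * (m * wD) := by linarith
    exact le_of_mul_le_mul_left this hμ0
  have h8 : xq * (b * w) ≤ xq * (m * wD) := by gcongr
  have h6 : xq ^ 2 * B ≤ b * xq ^ 2 * (xp + xq) + xq * wD := by
    have : m * (xq ^ 2 * B) ≤ m * (b * xq ^ 2 * (xp + xq) + xq * wD) := by linarith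
    exact le_of_mul_le_mul_left this hm0
  nlinarith

lemma W_filter_zero {E : Finset (Finset ℕ)} {x : ℕ → ℝ} {q : ℕ} (h : x q = 0) :
    W (E.filter (fun e => q ∉ e)) x = W E x := by
  unfold W
  refine sum_subset (filter_subset _ _) ?_
  intro e he hne
  have : q ∈ e := by
    by_contra hq; exact hne (mem_filter.2 ⟨he, hq⟩)
  exact prod_eq_zero this h

lemma Leg_pred {n : ℕ} {x : ℕ → ℝ} (hx : Leg (n+1) x) (h : x n = 0) : Leg n x := by
  refine ⟨hx.1, ?_, ?_⟩
  · intro i hi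
    rcases Nat.lt_or_ge n i with h' | h'
    · exact hx.2.1 i h'
    · have : i = n := by omega
      rw [this, h]
  · have := hx.2.2
    rw [sum_range_succ, h, add_zero] at this
    exact this

lemma filter_sub {n : ℕ} {E : Finset (Finset ℕ)} (hE : E ⊆ powersetCard 3 (range (n+1))) :
    E.filter (fun e => n ∉ e) ⊆ powersetCard 3 (range n) := by
  intro e he
  obtain ⟨he1, he2⟩ := mem_filter.1 he
  obtain ⟨h1, h2⟩ := mem_powersetCard.1 (hE he1)
  refine mem_powersetCard.2 ⟨fun a ha => ?_, h2⟩
  have h3 := mem_range.1 (h1 ha)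
  have h4 : a ≠ n := fun h => he2 (h ▸ ha)
  exact mem_range.2 (by omega)

lemma prod_ge {f : Finset ℕ} {x : ℕ → ℝ} {c : ℝ} (hc : 0 ≤ c) (h : ∀ a ∈ f, c ≤ x a) :
    c ^ f.card ≤ ∏ a ∈ f, x a := by
  rw [← prod_const]
  exact prod_le_prod (fun _ _ => hc) h

lemma step {t m : ℕ} (ht : 3 ≤ t) (htm : t ≤ m + 1) {Λ : ℝ}
    (ih : ∀ E x, Good t (t.choose 3 + (t-1).choose 2) (m+1) E → Leg (m+1) x → W E x ≤ Λ) :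
    ∀ E x, Good t (t.choose 3 + (t-1).choose 2) (m+2) E → Leg (m+2) x → W E x ≤ Λ := by
  intro E1 x1 hE1 hx1
  obtain ⟨E, x, hG, hx, hmax, hanti, hc, hcl⟩ :=
    exists_nice t _ (m+2) ⟨E1, hE1⟩ ⟨x1, hx1⟩
  refine (hmax E1 x1 hE1 hx1).trans ?_
  by_contra hcon
  push Not at hcon
  have hE := hG.1
  have hmaxE : ∀ y, Leg (m+2) y → W E y ≤ W E x := fun y hy => hmax E y hG hy
  have hclq : ∀ f ∈ powersetCard 3 (range t), m+1 ∉ f := by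
    intro f hf h
    have := mem_range.1 ((mem_powersetCard.1 hf).1 h)
    omega
  have hgood : ∀ D, D ⊆ powersetCard 3 (range (m+1)) →
      D.card ≤ (E.filter (fun e => m+1 ∈ e)).card →
      Good t (t.choose 3 + (t-1).choose 2) (m+1) (E.filter (fun e => m+1 ∉ e) ∪ D) := by
    intro D hD hDc
    refine ⟨union_subset (filter_sub hE) hD, ?_, range t, ?_, card_range t, ?_⟩
    · have h1 := card_union_le (E.filter (fun e => m+1 ∉ e)) D
      have h2 := card_filter_add_card_filter_not (s := E) (fun e => m+1 ∈ e)
      have h3 := hG.2.1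
      omega
    · intro a ha
      rw [mem_range] at *; omega
    · intro f hf
      exact mem_union_left _ (mem_filter.2 ⟨hcl hf, hclq f hf⟩)
  have hpos : 0 < x (m+1) := by
    rcases (hx.1 (m+1)).lt_or_eq with h | h
    · exact h
    · exfalso
      have h1 := ih _ x (hgood ∅ (empty_subset _) (by simp)) (Leg_pred hx h.symm)
      rw [union_empty, W_filter_zero h.symm] at h1
      linarith
  have hp : ∀ i, i < m+2 → 0 < x i :=
    fun i hi => hpos.trans_le (hanti i (m+1) (by omega) (by omega))
  have hT : ∀ a, a ∈ range m ↔ a < m+2 ∧ a ≠ m ∧ a ≠ m+1 := by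
    intro a; rw [mem_range]; omega
  have hfoc := foc hE hx hmaxE (i := m) (j := m+1) (by omega) (by omega) (by omega)
    (hp m (by omega)) hpos hT
  set B := Rk E (range m) m (m+1) x with hBdef
  have hBL : B = ∑ l ∈ LL E m, x l := rfl
  set xq := x (m+1) with hxq
  set y := shift x m (m+1) xq with hy
  have hyq : y (m+1) = 0 := by simp [hy, shift, hxq]
  have hym : y m = x m + xq := by simp [hy, shift]
  have hyo : ∀ a, a < m → y a = x a := by
    intro a ha
    have h1 : a ≠ m := by omega
    have h2 : a ≠ m+1 := by omega
    simp [hy, shift, h1, h2]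
  have hyL : Leg (m+1) y := by
    refine Leg_pred (Leg_shift hx (by omega) (by omega) (by omega) ?_ ?_) hyq
    · linarith [hp m (by omega)]
    · simp [hxq]
  have hWy : W E y = W E x - xq ^ 2 * B := by
    rw [hy, W_shift hE (by omega) hT, hfoc]; ring
  have hkey : ∀ D, D ⊆ powersetCard 3 (range (m+1)) \ E →
      D.card ≤ (E.filter (fun e => m+1 ∈ e)).card → W D y < xq ^ 2 * B := by
    intro D hD hDc
    have h1 := ih _ y (hgood D (hD.trans sdiff_subset) hDc) hyL
    have h2 : W (E.filter (fun e => m+1 ∉ e) ∪ D) y = W E y + W D y := by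
      rw [← W_filter_zero (E := E) hyq]
      unfold W
      rw [sum_union]
      rw [disjoint_left]
      intro e he hd
      exact (mem_sdiff.1 (hD hd)).2 (mem_filter.1 he).1
    rw [h2, hWy] at h1
    linarith
  have hBpos : 0 < B := by
    have h1 := hkey ∅ (empty_subset _) (by simp)
    have h2 : W ∅ y = 0 := by simp [W]
    rw [h2] at h1
    by_contra h
    push Not at h
    have := mul_nonneg (sq_nonneg xq) (neg_nonneg.2 h)
    linarith
  have hLne : (LL E m).Nonempty := by
    rw [nonempty_iff_ne_empty]
    intro h
    rw [hBL, h, sum_empty] at hBpos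
    exact lt_irrefl _ hBpos
  have hb1 : 1 ≤ (LL E m).card := card_pos.2 hLne
  have hr := ratio hE hx hmaxE hanti hc hpos (by omega) hLne
  rw [← hxq] at hr
  have hBle : B ≤ ((LL E m).card : ℝ) * x 0 := by
    rw [hBL, ← nsmul_eq_mul]
    refine sum_le_card_nsmul _ _ _ fun l hl => ?_
    have := mem_range.1 (mem_filter.1 hl).1
    exact hanti 0 l (by omega) (by omega)
  have hpq : xq ≤ x m := hanti m (m+1) (by omega) (by omega)
  have hxm : 0 < x m := hp m (by omega)
  have hwf : ∀ f ∈ powersetCard 2 (range m), x m ^ 2 ≤ ∏ a ∈ f, x a := by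
    intro f hf
    obtain ⟨h1, h2⟩ := mem_powersetCard.1 hf
    rw [← h2]
    refine prod_ge hxm.le fun a ha => ?_
    have := mem_range.1 (h1 ha)
    exact hanti a m (by omega) (by omega)
  have hwsum : ∀ D, D ⊆ powersetCard 2 (range m) →
      (D.card : ℝ) * x m ^ 2 ≤ ∑ f ∈ D, ∏ a ∈ f, x a := by
    intro D hD
    rw [← nsmul_eq_mul]
    exact card_nsmul_le_sum _ _ _ fun f hf => hwf f (hD hf)
  have hcardE : E.card = (E.filter (fun e => m+1 ∈ e)).card
      + (E.filter (fun e => m+1 ∉ e)).card :=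
    (card_filter_add_card_filter_not (s := E) (fun e => m+1 ∈ e)).symm
  rcases Nat.eq_or_lt_of_le htm with htm' | htm'
  · skip
    have hM1 : MM E m m = ∅ := by
      unfold MM
      rw [filter_eq_empty_iff]
      intro f hf
      rw [not_not]
      apply hcl
      obtain ⟨h1, h2⟩ := mem_powersetCard.1 hf
      have hmf : m ∉ f := fun h => by have := mem_range.1 (h1 h); omega
      rw [mem_powersetCard, card_insert_of_notMem hmf, h2]
      refine ⟨fun a ha => ?_, rfl⟩
      rw [mem_range, htm']
      rcases mem_insert.1 ha with h | h
      · omega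
      · have := mem_range.1 (h1 h); omega
    rw [hM1, sum_empty] at hr
    have hr' : x 0 - x m - xq ≤ 0 := by
      by_contra h
      push Not at h
      have hm0 : (0:ℝ) < m := by exact_mod_cast (by omega : 0 < m)
      have := mul_pos (mul_pos hm0 hpos) h
      linarith
    have hLk : Lk E (range m) m x - Lk E (range m) (m+1) x
        = ∑ f ∈ MM E m (m+1), ∏ a ∈ f, x a := by
      unfold Lk MM
      have h1 : (powersetCard 2 (range m)).filter (fun f => insert m f ∈ E)
          = powersetCard 2 (range m) := by
        have h2 : (powersetCard 2 (range m)).filter (fun f => ¬ insert m f ∈ E) = ∅ := hM1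
        rw [filter_eq_self]
        intro f hf
        by_contra h
        have : f ∈ (powersetCard 2 (range m)).filter (fun f => ¬ insert m f ∈ E) :=
          mem_filter.2 ⟨hf, h⟩
        rw [h2] at this
        simp at this
      rw [h1, ← sum_filter_add_sum_filter_not (powersetCard 2 (range m))
        (fun f => insert (m+1) f ∈ E)]
      ring
    have hcnt : (LL E m).card ≤ (MM E m (m+1)).card := by
      have h1 : t.choose 3 ≤ (E.filter (fun e => m+1 ∉ e)).card := by
        have : (powersetCard 3 (range t)).card = t.choose 3 := by simp
        rw [← this]
        exact card_le_card fun f hf => mem_filter.2 ⟨hcl hf, hclq f hf⟩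
      have h2 : (LL E m).card + ((powersetCard 2 (range m)).filter
          (fun f => insert (m+1) f ∈ E)).card ≤ (E.filter (fun e => m+1 ∈ e)).card := by
        have e1 : (LL E m).card ≤ (E.filter (fun e => m+1 ∈ e ∧ m ∈ e)).card := by
          refine card_le_card_of_injOn (fun j => insert m (insert (m+1) {j})) ?_ ?_
          · intro j hj
            have hj' := mem_filter.1 (mem_coe.1 hj)
            exact mem_coe.2 (mem_filter.2 ⟨hj'.2, by simp, by simp⟩)
          · intro a ha b hb hab
            have ha' := mem_filter.1 (mem_coe.1 ha)
            rw [mem_range] at ha'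
            have h1 : a ∈ insert m (insert (m+1) ({b} : Finset ℕ)) := by
              have : a ∈ insert m (insert (m+1) ({a} : Finset ℕ)) := by simp
              simp only at hab
              rwa [hab] at this
            simp only [mem_insert, mem_singleton] at h1
            omega
        have e2 : ((powersetCard 2 (range m)).filter (fun f => insert (m+1) f ∈ E)).card
            ≤ (E.filter (fun e => m+1 ∈ e ∧ ¬ m ∈ e)).card := by
          refine card_le_card_of_injOn (fun f => insert (m+1) f) ?_ ?_
          · intro f hf
            obtain ⟨h1, h2⟩ := mem_filter.1 (mem_coe.1 hf)
            refine mem_coe.2 (mem_filter.2 ⟨h2, by simp, ?_⟩)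
            rw [mem_insert]
            rintro (h | h)
            · omega
            · have := mem_range.1 ((mem_powersetCard.1 h1).1 h); omega
          · intro f hf g hg hfg
            have hnot : ∀ f ∈ (powersetCard 2 (range m)).filter (fun f => insert (m+1) f ∈ E),
                m+1 ∉ f := by
              intro f hf h
              have := mem_range.1 ((mem_powersetCard.1 (mem_filter.1 hf).1).1 h); omega
            rw [← erase_insert (hnot f hf), ← erase_insert (hnot g hg)]
            simp only at hfg
            rw [hfg]
        have e3 := card_filter_add_card_filter_not (s := E.filter (fun e => m+1 ∈ e))
          (fun e => m ∈ e)
        rw [filter_filter, filter_filter] at e3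
        omega
      have h3 := card_filter_add_card_filter_not (s := powersetCard 2 (range m))
          (fun f => insert (m+1) f ∈ E)
      have h4 : (powersetCard 2 (range m)).card = (t-1).choose 2 := by
        rw [card_powersetCard, card_range, htm']; rfl
      have h5 := hG.2.1
      have h6 : (MM E m (m+1)).card = ((powersetCard 2 (range m)).filter
          (fun f => ¬ insert (m+1) f ∈ E)).card := rfl
      omega
    exact case_eq (b := (LL E m).card) (d := (MM E m (m+1)).card) (by exact_mod_cast hb1) hpos hpq
      (by exact_mod_cast hcnt) (hwsum _ (filter_subset _ _)) (by rw [← hLk]; linarith) hBle hr'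
  · skip
    have hdeg := deg_bound hE hc
    set d := (E.filter (fun e => m+1 ∈ e)).card with hd
    have hdR : ((LL E m).card : ℝ) * ((m:ℝ) + 1) ≤ 2 * (d : ℝ) := by exact_mod_cast hdeg
    have hm3 : (3:ℝ) ≤ m := by exact_mod_cast (by omega : 3 ≤ m)
    have hbm : ((LL E m).card : ℝ) ≤ m := by
      have : (LL E m).card ≤ (range m).card := card_le_card (filter_subset _ _)
      rw [card_range] at this
      exact_mod_cast this
    have hMnot : ∀ f ∈ MM E m m, m ∉ f := by
      intro f hf h
      have := mem_range.1 ((mem_powersetCard.1 (mem_filter.1 hf).1).1 h); omega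
    have hinj : ∀ D ⊆ MM E m m, Set.InjOn (fun f : Finset ℕ => insert m f) D := by
      intro D hD f hf g hg hfg
      rw [← erase_insert (hMnot f (hD hf)), ← erase_insert (hMnot g (hD hg))]
      simp only at hfg
      rw [hfg]
    have himg : ∀ D ⊆ MM E m m, D.image (fun f => insert m f) ⊆ powersetCard 3 (range (m+1)) \ E := by
      intro D hD e he
      obtain ⟨f, hf, rfl⟩ := mem_image.1 he
      have hf' := hD hf
      obtain ⟨h1, h2⟩ := mem_filter.1 hf'
      obtain ⟨h3, h4⟩ := mem_powersetCard.1 h1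
      refine mem_sdiff.2 ⟨mem_powersetCard.2 ⟨?_, ?_⟩, h2⟩
      · intro a ha
        rw [mem_range]
        rcases mem_insert.1 ha with h | h
        · omega
        · have := mem_range.1 (h3 h); omega
      · rw [card_insert_of_notMem (hMnot f hf'), h4]
    have hWimg : ∀ D ⊆ MM E m m, W (D.image (fun f => insert m f)) y
        = (x m + xq) * ∑ f ∈ D, ∏ a ∈ f, x a := by
      intro D hD
      unfold W
      rw [sum_image (hinj D hD), mul_sum]
      refine sum_congr rfl fun f hf => ?_
      rw [prod_insert (hMnot f (hD hf)), hym]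
      congr 1
      refine prod_congr rfl fun a ha => hyo a ?_
      exact mem_range.1 ((mem_powersetCard.1 (mem_filter.1 (hD hf)).1).1 ha)
    have hMA : MM E m m ⊆ powersetCard 2 (range m) := filter_subset _ _
    have hw0 : 0 ≤ ∑ f ∈ MM E m m, ∏ a ∈ f, x a :=
      sum_nonneg fun f _ => prod_nonneg fun a _ => hx.1 a
    rcases le_or_gt (MM E m m).card d with hμ | hμ
    · skip
      have hN : d ≤ (powersetCard 3 (range (m+1)) \ E).card := by
        have h1 : powersetCard 3 (range (m+1)) \ E
            = powersetCard 3 (range (m+1)) \ (E.filter (fun e => m+1 ∉ e)) := by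
          ext e
          simp only [mem_sdiff, mem_filter, mem_powersetCard]
          refine ⟨fun h => ⟨h.1, fun h' => h.2 h'.1⟩, fun h => ⟨h.1, fun h' => h.2 ⟨h', fun h'' => ?_⟩⟩⟩
          have := mem_range.1 (h.1.1 h''); omega
        rw [h1, card_sdiff_of_subset (filter_sub hE), card_powersetCard, card_range]
        have h2 : t.choose 3 + (t-1).choose 2 ≤ (m+1).choose 3 := by
          have e1 : (t+1).choose 3 ≤ (m+1).choose 3 := Nat.choose_le_choose 3 (by omega)
          have e2 : (t+1).choose 3 = t.choose 2 + t.choose 3 := Nat.choose_succ_succ t 2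
          have e3 : (t-1).choose 2 ≤ t.choose 2 := Nat.choose_le_choose 2 (by omega)
          omega
        have h3 := hG.2.1
        omega
      have himc : ((MM E m m).image (fun f => insert m f)).card = (MM E m m).card :=
        card_image_of_injOn (hinj _ (Subset.refl _))
      obtain ⟨D, hD1, hD2, hD3⟩ := exists_subsuperset_card_eq (himg _ (Subset.refl _))
        (by rw [himc]; exact hμ) hN
      have hlt := hkey D hD2 hD3.le
      refine case1 (b := (LL E m).card) (m := m) (d := d) (μ := (MM E m m).card)
        (by positivity) hm3 hpos hpq hbm hBle hr (hwsum _ hMA) hw0 hdR ?_ hlt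
      have h5 : W D y = W (D \ (MM E m m).image (fun f => insert m f)) y
          + W ((MM E m m).image (fun f => insert m f)) y := by
        unfold W
        rw [sum_sdiff hD1]
      have h6 : ((d : ℝ) - (MM E m m).card) * x m ^ 3
          ≤ W (D \ (MM E m m).image (fun f => insert m f)) y := by
        have h7 : ((D \ (MM E m m).image (fun f => insert m f)).card : ℝ)
            = (d : ℝ) - (MM E m m).card := by
          rw [card_sdiff_of_subset hD1, himc, hD3, Nat.cast_sub hμ]
        rw [← h7, ← nsmul_eq_mul]
        unfold W
        refine card_nsmul_le_sum _ _ _ fun e he => ?_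
        obtain ⟨h8, h9⟩ := mem_powersetCard.1 (mem_sdiff.1 (hD2 (mem_sdiff.1 he).1)).1
        rw [← h9]
        refine prod_ge hxm.le fun a ha => ?_
        have h10 := mem_range.1 (h8 ha)
        rcases Nat.lt_or_ge a m with h | h
        · rw [hyo a h]; exact hanti a m (by omega) (by omega)
        · have : a = m := by omega
          rw [this, hym]; linarith
      rw [h5, hWimg _ (Subset.refl _)]
      linarith
    · obtain ⟨D, hD1, hD2, hD3⟩ := exists_avg_subset (fun f : Finset ℕ => ∏ a ∈ f, x a) d
        (MM E m m) hμ.le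
      have hlt := hkey _ (himg D hD1) (by rw [card_image_of_injOn (hinj D hD1), hD2])
      have hμ2 : 2 * ((MM E m m).card : ℝ) ≤ (m:ℝ) * ((m:ℝ) + 1) := by
        have h1 := card_le_card hMA
        rw [card_powersetCard, card_range, Nat.choose_two_right] at h1
        have h2 : (MM E m m).card * 2 ≤ m * (m - 1) :=
          (Nat.mul_le_mul_right 2 h1).trans (Nat.div_mul_le_self _ _)
        have h3 : m * (m - 1) ≤ m * (m + 1) := Nat.mul_le_mul_left _ (by omega)
        have h4 : 2 * (MM E m m).card ≤ m * (m + 1) := by omega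
        exact_mod_cast h4
      refine case2 (b := (LL E m).card) (m := m) (d := d) (μ := (MM E m m).card)
        (by positivity) hm3 hpos hpq hBle hr hw0 (by exact_mod_cast (by omega)) hμ2
        (hD2 ▸ hwsum D (hD1.trans hMA)) hD3 hdR (hWimg D hD1).ge hlt


lemma e2_eq (x : ℕ → ℝ) (s : Finset ℕ) :
    2 * ∑ f ∈ powersetCard 2 s, ∏ a ∈ f, x a = (∑ a ∈ s, x a) ^ 2 - ∑ a ∈ s, x a ^ 2 := by
  induction s using Finset.induction_on with
  | empty =>
    have h : powersetCard 2 (∅ : Finset ℕ) = ∅ := by rfl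
    simp [h]
  | insert b s hb ih =>
    have hdis : Disjoint (powersetCard 2 s) ((powersetCard 1 s).image (insert b)) := by
      rw [disjoint_left]
      intro f hf hg
      obtain ⟨g, _, rfl⟩ := mem_image.1 hg
      exact hb ((mem_powersetCard.1 hf).1 (mem_insert_self _ _))
    have hnot : ∀ r, ∀ f ∈ powersetCard r s, b ∉ f :=
      fun r f hf h => hb ((mem_powersetCard.1 hf).1 h)
    have h1 : ∑ f ∈ (powersetCard 1 s).image (insert b), ∏ a ∈ f, x a
        = x b * ∑ a ∈ s, x a := by
      rw [sum_image, mul_sum, powersetCard_one, sum_map]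
      · refine sum_congr rfl fun a ha => ?_
        have : b ∉ ({a} : Finset ℕ) := by
          rw [mem_singleton]; rintro rfl; exact hb ha
        simp [prod_insert this]
      · intro f hf g hg hfg
        rw [← erase_insert (hnot 1 f hf), ← erase_insert (hnot 1 g hg), hfg]
    rw [powersetCard_succ_insert hb, sum_union hdis, h1, sum_insert hb, sum_insert hb]
    linear_combination ih

lemma e3_eq (x : ℕ → ℝ) (s : Finset ℕ) :
    6 * ∑ f ∈ powersetCard 3 s, ∏ a ∈ f, x a = (∑ a ∈ s, x a) ^ 3
      - 3 * (∑ a ∈ s, x a) * (∑ a ∈ s, x a ^ 2) + 2 * ∑ a ∈ s, x a ^ 3 := by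
  induction s using Finset.induction_on with
  | empty =>
    have h : powersetCard 3 (∅ : Finset ℕ) = ∅ := by rfl
    simp [h]
  | insert b s hb ih =>
    have hdis : Disjoint (powersetCard 3 s) ((powersetCard 2 s).image (insert b)) := by
      rw [disjoint_left]
      intro f hf hg
      obtain ⟨g, _, rfl⟩ := mem_image.1 hg
      exact hb ((mem_powersetCard.1 hf).1 (mem_insert_self _ _))
    have hnot : ∀ r, ∀ f ∈ powersetCard r s, b ∉ f :=
      fun r f hf h => hb ((mem_powersetCard.1 hf).1 h)
    have h1 : ∑ f ∈ (powersetCard 2 s).image (insert b), ∏ a ∈ f, x a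
        = x b * ∑ f ∈ powersetCard 2 s, ∏ a ∈ f, x a := by
      rw [sum_image, mul_sum]
      · refine sum_congr rfl fun f hf => ?_
        rw [prod_insert (hnot 2 f hf)]
      · intro f hf g hg hfg
        rw [← erase_insert (hnot 2 f hf), ← erase_insert (hnot 2 g hg), hfg]
    rw [powersetCard_succ_insert hb, sum_union hdis, h1, sum_insert hb, sum_insert hb,
      sum_insert hb]
    linear_combination ih + 3 * x b * e2_eq x s

lemma base {t : ℕ} (ht : 3 ≤ t) {E : Finset (Finset ℕ)} {x : ℕ → ℝ}
    (hE : E ⊆ powersetCard 3 (range t)) (hx : Leg t x) :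
    W E x ≤ ((t : ℝ) - 1) * ((t : ℝ) - 2) / (6 * (t : ℝ) ^ 2) := by
  have h1 : W E x ≤ ∑ f ∈ powersetCard 3 (range t), ∏ a ∈ f, x a :=
    sum_le_sum_of_subset_of_nonneg hE (fun f _ _ => prod_nonneg fun a _ => hx.1 a)
  refine h1.trans ?_
  have h2 := e3_eq x (range t)
  rw [hx.2.2] at h2
  have ht0 : (0:ℝ) < t := by exact_mod_cast (by omega : 0 < t)
  rcases Nat.eq_or_lt_of_le ht with h3 | h3
  · subst h3
    have h4 := hx.2.2
    simp only [sum_range_succ, sum_range_zero] at h4 h2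
    have ha := hx.1 0
    have hb := hx.1 1
    have hc := hx.1 2
    generalize x 0 = a at *
    generalize x 1 = b at *
    generalize x 2 = c at *
    have h5 : c = 1 - a - b := by linarith
    have h6 : ∑ f ∈ powersetCard 3 (range 3), ∏ i ∈ f, x i = a * b * c := by
      rw [h5] at h2 ⊢; linarith [h2]
    rw [h6]
    norm_num
    subst h5
    nlinarith [mul_nonneg ha (sq_nonneg (b - (1 - a - b))), mul_nonneg hb (sq_nonneg (a - (1 - a - b))),
      mul_nonneg hc (sq_nonneg (a - b)), sq_nonneg (a - b), sq_nonneg (a - (1 - a - b)),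
      sq_nonneg (b - (1 - a - b))]
  · have ht4 : (4:ℝ) ≤ t := by exact_mod_cast h3
    set c : ℝ := 1 / t with hc
    have hc4 : c ≤ 1 / 4 := one_div_le_one_div_of_le (by norm_num) ht4
    have hc0 : 0 < c := by positivity
    have hct : (t:ℝ) * c = 1 := by rw [hc]; field_simp
    have h5 : ∑ a ∈ range t, (2 * x a ^ 3 - 3 * x a ^ 2) ≤
        ∑ a ∈ range t, (2 * c ^ 3 - 3 * c ^ 2 + (6 * c ^ 2 - 6 * c) * (x a - c)) := by
      refine sum_le_sum fun a _ => ?_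
      have h6 := hx.le_one a
      have h7 : 0 ≤ (x a - c) ^ 2 * (3 - 2 * x a - 4 * c) :=
        mul_nonneg (sq_nonneg _) (by linarith)
      nlinarith
    have hl : ∑ a ∈ range t, (2 * x a ^ 3 - 3 * x a ^ 2)
        = 2 * ∑ a ∈ range t, x a ^ 3 - 3 * ∑ a ∈ range t, x a ^ 2 := by
      rw [sum_sub_distrib, ← mul_sum, ← mul_sum]
    have hm : ∑ a ∈ range t, (x a - c) = 0 := by
      rw [sum_sub_distrib, hx.2.2, sum_const, card_range, nsmul_eq_mul, hct, sub_self]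
    rw [hl, sum_add_distrib, sum_const, card_range, ← mul_sum, hm, nsmul_eq_mul] at h5
    have h8 : ((t : ℝ) - 1) * ((t : ℝ) - 2) / (6 * (t : ℝ) ^ 2) = (1 - c) * (1 - 2 * c) / 6 := by
      rw [hc]; field_simp
    rw [h8]
    have h9 : (t:ℝ) * (2 * c ^ 3 - 3 * c ^ 2) = 2 * c ^ 2 - 3 * c := by
      linear_combination (2 * c ^ 2 - 3 * c) * hct
    rw [h9] at h5
    linarith

lemma main {t : ℕ} (ht : 3 ≤ t) (r : ℕ) : ∀ E x,
    Good t (t.choose 3 + (t-1).choose 2) (t + r) E → Leg (t + r) x →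
    W E x ≤ ((t : ℝ) - 1) * ((t : ℝ) - 2) / (6 * (t : ℝ) ^ 2) := by
  induction r with
  | zero =>
    intro E x hE hx
    exact base ht hE.1 hx
  | succ r ih =>
    obtain ⟨m, hm⟩ : ∃ m, t + r = m + 1 := ⟨t + r - 1, by omega⟩
    rw [hm] at ih
    have h2 : t + (r + 1) = m + 2 := by omega
    rw [h2]
    exact step ht (by omega) ih

lemma choose_three (n : ℕ) : 6 * (n.choose 3 : ℝ) = n * ((n:ℝ) - 1) * ((n:ℝ) - 2) := by
  induction n with
  | zero => simp
  | succ n ih =>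
    have : (n+1).choose 3 = n.choose 2 + n.choose 3 := Nat.choose_succ_succ n 2
    rw [this]
    push_cast
    have h2 := Nat.cast_choose_two ℝ n
    rw [h2]
    linear_combination ih

lemma fin_upper {t n : ℕ} (ht : 3 ≤ t) (E : Finset (Finset (Fin n))) (h3 : ∀ e ∈ E, e.card = 3)
    (hhigh : E.card ≤ t.choose 3 + (t - 1).choose 2)
    (S : Finset (Fin n)) (hS : S.card = t) (hSE : isCompleteSub E ({3} : Finset ℕ) S)
    (x : Fin n → ℝ) (hx : isLegal x) :
    lagPolyU E x ≤ ((t : ℝ) - 1) * ((t : ℝ) - 2) / (6 * (t : ℝ) ^ 2) := by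
  have htn : t ≤ n := by
    rw [← hS]; simpa using card_le_univ S
  obtain ⟨r, rfl⟩ := Nat.exists_eq_add_of_le htn
  set E' := E.image (fun e => e.map Fin.valEmbedding) with hE'
  let x' : ℕ → ℝ := fun i => if h : i < t + r then x ⟨i, h⟩ else 0
  have hx' : ∀ i : Fin (t + r), x' i = x i := by
    intro i; simp [x', i.2]
  have hW : W E' x' = lagPolyU E x := by
    unfold W lagPolyU
    rw [hE', sum_image (fun a _ b _ h => map_injective _ h)]
    refine sum_congr rfl fun e _ => ?_
    rw [prod_map]
    exact prod_congr rfl fun i _ => hx' i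
  rw [← hW]
  refine main ht r E' x' ⟨?_, card_image_le.trans hhigh, S.map Fin.valEmbedding, ?_, ?_, ?_⟩
    ⟨?_, ?_, ?_⟩
  · intro e he
    obtain ⟨f, hf, rfl⟩ := mem_image.1 he
    rw [mem_powersetCard, card_map]
    refine ⟨fun a ha => ?_, h3 f hf⟩
    obtain ⟨b, _, rfl⟩ := mem_map.1 ha
    exact mem_range.2 b.2
  · intro a ha
    obtain ⟨b, _, rfl⟩ := mem_map.1 ha
    exact mem_range.2 b.2
  · rw [card_map, hS]
  · intro e he
    obtain ⟨h1, h2⟩ := mem_powersetCard.1 he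
    obtain ⟨f, hf, rfl⟩ := subset_map_iff.1 h1
    rw [card_map] at h2
    exact mem_image.2 ⟨f, hSE f hf (by simp [h2]), rfl⟩
  · intro i
    simp only [x']
    split_ifs
    · exact hx.2 _
    · exact le_rfl
  · intro i hi
    simp [x', not_lt.2 hi]
  · rw [← hx.1, ← Fin.sum_univ_eq_sum_range]
    exact sum_congr rfl fun i _ => hx' i

lemma lag_eq {t n : ℕ} (ht : 3 ≤ t) (E : Finset (Finset (Fin n))) (h3 : ∀ e ∈ E, e.card = 3)
    (hhigh : E.card ≤ t.choose 3 + (t - 1).choose 2)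
    (S : Finset (Fin n)) (hS : S.card = t) (hSE : isCompleteSub E ({3} : Finset ℕ) S) :
    lagrangianU E = ((t : ℝ) - 1) * ((t : ℝ) - 2) / (6 * (t : ℝ) ^ 2) := by
  have ht0 : (0:ℝ) < t := by exact_mod_cast (by omega : 0 < t)
  have hup := fin_upper ht E h3 hhigh S hS hSE
  let x : Fin n → ℝ := fun i => if i ∈ S then 1 / (t:ℝ) else 0
  have hx0 : ∀ i, 0 ≤ x i := by
    intro i; simp only [x]; split_ifs <;> positivity
  have hx : isLegal x := by
    refine ⟨?_, hx0⟩
    simp only [x]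
    rw [sum_ite_mem, univ_inter, sum_const, hS, nsmul_eq_mul]
    field_simp
  have hlow : ((t : ℝ) - 1) * ((t : ℝ) - 2) / (6 * (t : ℝ) ^ 2) ≤ lagPolyU E x := by
    have hsub : powersetCard 3 S ⊆ E := fun e he =>
      hSE e (mem_powersetCard.1 he).1 (by simp [(mem_powersetCard.1 he).2])
    have h1 : ∑ e ∈ powersetCard 3 S, ∏ i ∈ e, x i ≤ lagPolyU E x :=
      sum_le_sum_of_subset_of_nonneg hsub (fun f _ _ => prod_nonneg fun a _ => hx0 a)
    refine le_trans (le_of_eq ?_) h1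
    have h2 : ∑ e ∈ powersetCard 3 S, ∏ i ∈ e, x i = ∑ e ∈ powersetCard 3 S, (1 / (t:ℝ)) ^ 3 := by
      refine sum_congr rfl fun e he => ?_
      obtain ⟨h3, h4⟩ := mem_powersetCard.1 he
      rw [← h4, ← prod_const]
      refine prod_congr rfl fun i hi => ?_
      simp [x, h3 hi]
    rw [h2, sum_const, card_powersetCard, hS, nsmul_eq_mul]
    have h5 : (t.choose 3 : ℝ) = t * ((t:ℝ) - 1) * ((t:ℝ) - 2) / 6 := by
      linarith [choose_three t]
    rw [h5]
    field_simp
  unfold lagrangianU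
  apply le_antisymm
  · refine csSup_le ⟨_, x, hx, rfl⟩ ?_
    rintro v ⟨y, hy, rfl⟩
    exact hup y hy
  · refine hlow.trans (le_csSup
      ⟨((t : ℝ) - 1) * ((t : ℝ) - 2) / (6 * (t : ℝ) ^ 2), ?_⟩ ⟨x, hx, rfl⟩)
    rintro v ⟨y, hy, rfl⟩
    exact hup y hy

end LagT

/-- Theorem 4 of the paper: a 3-graph with m edges, C(t,3) ≤ m ≤ C(t,3)+C(t-1,2), containing a
clique of order t, has the Lagrangian of [t]^(3). -/
theorem lagrangian_three_graph_with_clique (t m n : ℕ) (ht : 3 ≤ t)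
    (E : Finset (Finset (Fin n))) (h3 : ∀ e ∈ E, e.card = 3)
    (hm : E.card = m)
    (hlow : Nat.choose t 3 ≤ m) (hhigh : m ≤ Nat.choose t 3 + Nat.choose (t - 1) 2)
    (hclique : ∃ S : Finset (Fin n), S.card = t ∧ isCompleteSub E ({3} : Finset ℕ) S) :
    lagrangianU E = lagrangianU (completeEdges t ({3} : Finset ℕ)) ∧
    lagrangianU (completeEdges t ({3} : Finset ℕ)) =
      ((t : ℝ) - 1) * ((t : ℝ) - 2) / (6 * (t : ℝ) ^ 2) := by
  obtain ⟨S, hS, hSE⟩ := hclique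
  have h1 := LagT.lag_eq ht E h3 (hm ▸ hhigh) S hS hSE
  have h2 : lagrangianU (completeEdges t ({3} : Finset ℕ)) =
      ((t : ℝ) - 1) * ((t : ℝ) - 2) / (6 * (t : ℝ) ^ 2) := by
    have hmem : ∀ e, e ∈ completeEdges t ({3} : Finset ℕ) ↔ e.card = 3 := by
      intro e; simp [completeEdges]
    refine LagT.lag_eq ht _ (fun e he => (hmem e).1 he) ?_ Finset.univ (by simp) ?_
    · have : completeEdges t ({3} : Finset ℕ) = powersetCard 3 Finset.univ := by
        ext e; rw [hmem, mem_powersetCard]; simp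
      rw [this, card_powersetCard]; simp
    · intro e _ he
      rw [hmem]; simpa using he
  exact ⟨h1.trans h2.symm, h2⟩
end

section
/- Let s ≥ 3 be an integer and let G be a 3-uniform hypergraph. If G contains two distinct complete 3-uniform subgraphs of order s (i.e., two distinct s-element vertex subsets each of which has all of its 3-element subsets as edges of G), then the number of edges of G is at least C(s,3) + C(s-1,2). -/
open Finset

/-- A 3-uniform hypergraph containing two distinct complete 3-uniform subgraphs of order s has at
least C(s,3) + C(s-1,2) edges. -/
theorem two_cliques_edge_bound {V : Type*} [DecidableEq V] (s : ℕ) (hs : 3 ≤ s)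
    (E : Finset (Finset V)) (h3 : ∀ e ∈ E, e.card = 3)
    (S1 S2 : Finset V) (hne : S1 ≠ S2) (hc1 : S1.card = s) (hc2 : S2.card = s)
    (hcl1 : ∀ e ⊆ S1, e.card = 3 → e ∈ E) (hcl2 : ∀ e ⊆ S2, e.card = 3 → e ∈ E) :
    Nat.choose s 3 + Nat.choose (s - 1) 2 ≤ E.card := by
  have hx : ∃ x ∈ S2, x ∉ S1 := by
    by_contra hcon
    push Not at hcon
    exact hne (Finset.eq_of_subset_of_card_le hcon (by omega)).symm
  obtain ⟨x, hx2, hx1⟩ := hx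
  have hnot : ∀ t ∈ powersetCard 2 (S2.erase x), x ∉ t := by
    intro t ht hxt
    have := (mem_powersetCard.mp ht).1 hxt
    simp at this
  have hcard : ((powersetCard 2 (S2.erase x)).image (insert x)).card = (s - 1).choose 2 := by
    rw [card_image_of_injOn, card_powersetCard, card_erase_of_mem hx2, hc2]
    intro a ha b hb hab
    have h1 := hnot a ha
    have h2 := hnot b hb
    rw [← erase_insert h1, ← erase_insert h2]
    exact congrArg (fun t => t.erase x) hab
  have hdisj : Disjoint (powersetCard 3 S1) ((powersetCard 2 (S2.erase x)).image (insert x)) := by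
    rw [disjoint_left]
    intro e he he'
    obtain ⟨t, _, rfl⟩ := mem_image.mp he'
    exact hx1 ((mem_powersetCard.mp he).1 (mem_insert_self x t))
  rw [← hcard, ← hc1, ← card_powersetCard, ← card_union_of_disjoint hdisj]
  apply card_le_card
  apply union_subset
  · intro e he
    exact hcl1 e (mem_powersetCard.mp he).1 (mem_powersetCard.mp he).2
  · intro e he
    obtain ⟨t, ht, rfl⟩ := mem_image.mp he
    have hm := mem_powersetCard.mp ht
    apply hcl2
    · exact insert_subset hx2 (hm.1.trans (erase_subset x S2))
    · rw [card_insert_of_notMem (hnot t ht), hm.2]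
end
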